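/- arXiv:0906.1272 — 11 statements merged into one kernel-verified Lean document; each statement's English description precedes it below -/
import Mathlib

section
/- Let A be a non-unital associative ring with no 2-torsion (i.e. 2x = 0 implies x = 0) satisfying the identity xyz + xzy = 0 for all x, y, z ∈ A. Then A is nilpotent of degree 4: every product of four elements vanishes, i.e. wxyz = 0 for all w, x, y, z ∈ A. -/
/-- A non-unital associative ring with no 2-torsion satisfying the identity
`xyz + xzy = 0` is nilpotent of degree 4. -/
theorem dualRightAlternative_nilpotent_degree_four
    (A : Type*) [NonUnitalRing A]
    (htor : ∀ x : A, 2 • x = 0 → x = 0)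
    (hid : ∀ x y z : A, x * y * z + x * z * y = 0) :
    ∀ w x y z : A, w * x * y * z = 0 := by
  intro w x y z
  have swap_left : w * x * y * z = -(w * y * x * z) := by
    rw [eq_neg_of_add_eq_zero_left (hid w x y), neg_mul]
  have swap_right : w * y * x * z = -(w * y * z * x) :=
    eq_neg_of_add_eq_zero_left (hid (w * y) x z)
  have move_product : w * x * y * z = -(w * y * z * x) := by
    simpa only [mul_assoc] using eq_neg_of_add_eq_zero_left (hid w x (y * z))
  apply htor
  rw [two_nsmul]
  nth_rewrite 1 [swap_left]
  rw [swap_right, move_product, neg_neg, add_neg_cancel]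
end

section
/- Let A be a non-unital associative ring with no 2-torsion (i.e. 2x = 0 implies x = 0) satisfying the identity xyz + yxz = 0 for all x, y, z ∈ A. Then A is nilpotent of degree 4: every product of four elements vanishes, i.e. wxyz = 0 for all w, x, y, z ∈ A. -/
/-- A non-unital associative ring with no 2-torsion satisfying the identity
`xyz + yxz = 0` is nilpotent of degree 4. -/
theorem dualLeftAlternative_nilpotent_degree_four
    (A : Type*) [NonUnitalRing A]
    (htor : ∀ x : A, 2 • x = 0 → x = 0)
    (hid : ∀ x y z : A, x * y * z + y * x * z = 0) :
    ∀ w x y z : A, w * x * y * z = 0 := by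
  intro w x y z
  have h₁ : w * x * y * z + y * w * x * z = 0 := by
    simpa only [mul_assoc] using hid (w * x) y z
  have h₂ : w * x * y * z + w * y * x * z = 0 := by
    simpa only [mul_add, mul_zero, mul_assoc] using congrArg (w * ·) (hid x y z)
  have h₃ : w * y * x * z + y * w * x * z = 0 := by
    simpa only [add_mul, zero_mul] using congrArg (· * z) (hid w y x)
  apply htor
  calc 2 • (w * x * y * z)
      = (w * x * y * z + y * w * x * z) + (w * x * y * z + w * y * x * z)
          - (w * y * x * z + y * w * x * z) := by abel
    _ = 0 := by rw [h₁, h₂, h₃]; simp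
end

section
/- Let A be any non-unital associative ring satisfying the identity xyz + xzy = 0 for all x, y, z ∈ A. Then for all w, x, y, z ∈ A one has wxyz = -(wxyz), i.e. 2·(wxyz) = 0. -/
/-- In a non-unital associative ring satisfying `xyz + xzy = 0`, every product
of four elements equals its own negative. -/
theorem dualRightAlternative_product_of_four_self_neg
    (A : Type*) [NonUnitalRing A]
    (hid : ∀ x y z : A, x * y * z + x * z * y = 0) :
    ∀ w x y z : A, w * x * y * z = -(w * x * y * z) := by
  have swap (x y z : A) : x * y * z = -(x * z * y) := eq_neg_of_add_eq_zero_left (hid x y z)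
  intro w x y z
  calc w * x * y * z = -(w * y * x * z) := by rw [swap w x y, neg_mul]
    _ = -(w * (y * x * z)) := by simp only [mul_assoc]
    _ = w * (y * z * x) := by rw [swap y x z, mul_neg, neg_neg]
    _ = w * (y * z) * x := (mul_assoc _ _ _).symm
    _ = -(w * x * (y * z)) := swap _ _ _
    _ = -(w * x * y * z) := by rw [← mul_assoc]
end

section
/- Let A be a non-unital associative algebra over a field F whose characteristic is different from 2 and 3, satisfying the symmetric-sum identity xyz + yxz + zxy + xzy + yzx + zyx = 0 for all x, y, z ∈ A. Then A is nilpotent of degree 6: every product of six elements of A vanishes. -/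
/-- The symmetric-sum identity of dual alternative algebras. -/
def SymmetricSumZero (A : Type*) [NonUnitalRing A] : Prop :=
  ∀ x y z : A, x * y * z + y * x * z + z * x * y + x * z * y + y * z * x + z * y * x = 0

namespace SymmetricSumZero

variable {A : Type*} [NonUnitalRing A] (hid : SymmetricSumZero A)
  (h2 : ∀ a : A, a + a = 0 → a = 0) (h3 : ∀ a : A, a + a + a = 0 → a = 0)

include hid h2

theorem sq_mul (p y : A) : p * p * y + p * y * p + y * p * p = 0 := by
  apply h2
  linear_combination (norm := noncomm_ring) hid p p y

include h3

theorem sq_mul_sq (p z q : A) : p * p * z * (q * q) = 0 := by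
  have T := hid.sq_mul h2
  apply h3
  linear_combination (norm := noncomm_ring)
    T p z * (q * q) + T p (z * q) * q + T p (z * q * q) - z * T q (p * p) - p * z * T q p

theorem jordan_mul_sq (p q z x : A) : (p * q + q * p) * z * (x * x) = 0 := by
  have H := hid.sq_mul_sq h2 h3
  linear_combination (norm := noncomm_ring) H (p + q) z x - H p z x - H q z x

theorem sq_mul_jordan (x z p q : A) : x * x * z * (p * q + q * p) = 0 := by
  have H := hid.sq_mul_sq h2 h3
  linear_combination (norm := noncomm_ring) H x z (p + q) - H x z p - H x z q

theorem mul_four_sq (a b c d x : A) : a * b * c * d * (x * x) = 0 := by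
  have H := hid.jordan_mul_sq h2 h3
  apply h2
  linear_combination (norm := noncomm_ring)
    H (a * b) c d x - H a c (b * d) x + a * H b c d x

theorem sq_mul_four (x a b c d : A) : x * x * a * b * c * d = 0 := by
  have H := hid.sq_mul_jordan h2 h3
  apply h2
  linear_combination (norm := noncomm_ring)
    H x a (b * c) d - H x a b d * c + H x (a * b) c d

theorem swap_last (a b c d e f : A) : a * b * c * d * e * f = -(a * b * c * d * f * e) := by
  have H := hid.mul_four_sq h2 h3 a b c d
  linear_combination (norm := noncomm_ring) H (e + f) - H e - H f

theorem swap_first (a b c d e f : A) : a * b * c * d * e * f = -(b * a * c * d * e * f) := by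
  have H := fun x => hid.sq_mul_four h2 h3 x c d e f
  linear_combination (norm := noncomm_ring) H (a + b) - H a - H b

theorem jordan_sq_mul (p q x f : A) (hp : ∃ r s, p = r * s) :
    (p * q + q * p) * (x * x) * f = -(f * (x * x) * (p * q + q * p)) := by
  obtain ⟨r, s, rfl⟩ := hp
  linear_combination (norm := noncomm_ring)
    hid (x * x) (r * s * q + q * (r * s)) f
      - hid.sq_mul_jordan h2 h3 x f (r * s) q - hid.jordan_mul_sq h2 h3 (r * s) q f x
      - hid.sq_mul_four h2 h3 x r s q f - hid.sq_mul_four h2 h3 x q r s f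
      - hid.mul_four_sq h2 h3 f r s q x - hid.mul_four_sq h2 h3 f q r s x

theorem sq_sq_skew (a x y e : A) : a * (x * x) * (y * y) * e = -(a * (y * y) * (x * x) * e) := by
  linear_combination (norm := noncomm_ring)
    hid (x * x) (y * y) a * e - hid.sq_mul_four h2 h3 x y y a e
      - hid.sq_mul_four h2 h3 y x x a e - hid.sq_mul_sq h2 h3 x a y * e
      - hid.sq_mul_sq h2 h3 y a x * e

theorem sq_sq_symm (a x y e : A) : a * (x * x) * (y * y) * e = e * (x * x) * (y * y) * a := by
  linear_combination (norm := noncomm_ring)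
    hid.jordan_sq_mul h2 h3 (x * x) a y e ⟨x, x, rfl⟩ - hid.sq_mul_sq h2 h3 x a y * e
      - e * hid.sq_mul_sq h2 h3 y a x - hid.sq_sq_skew h2 h3 e x y a

theorem sq_sq_exchange (a b d : A) :
    a * (b * b) * (d * d) * a = b * (a * a) * (d * d) * b := by
  have T := hid.sq_mul h2
  have H := hid.sq_mul_sq h2 h3
  have S := fun x => hid.sq_sq_symm h2 h3 b x d a
  linear_combination (norm := noncomm_ring)
    T b a * (d * d) * a - T a b * (d * d) * b - H b a d * a + H a b d * b
      - (S (a + b) - S a - S b) + H b a d * a - H a b d * b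

theorem mul_sq_sq_mul (a x y e : A) : a * (x * x) * (y * y) * e = 0 := by
  have E := hid.sq_sq_exchange h2 h3
  have K := hid.sq_sq_skew h2 h3
  have Z : ∀ a b d : A, a * (b * b) * (d * d) * a = 0 := by
    intro a b d
    apply h2
    have h : a * (b * b) * (d * d) * a = -(a * (b * b) * (d * d) * a) :=
      calc _ = b * (a * a) * (d * d) * b := E a b d
        _ = -(b * (d * d) * (a * a) * b) := K ..
        _ = -(d * (b * b) * (a * a) * d) := by rw [E]
        _ = d * (a * a) * (b * b) * d := by rw [K, neg_neg]
        _ = a * (d * d) * (b * b) * a := E ..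
        _ = _ := K ..
    exact add_eq_zero_iff_eq_neg.mpr h
  apply h2
  linear_combination (norm := noncomm_ring)
    Z (a + e) x y - Z a x y - Z e x y + hid.sq_sq_symm h2 h3 a x y e

theorem mul_sq_jordan_mul (a x y z e : A) : a * (x * x) * (y * z + z * y) * e = 0 := by
  have H := fun t => hid.mul_sq_sq_mul h2 h3 a x t e
  linear_combination (norm := noncomm_ring) H (y + z) - H y - H z

theorem mul_jordan_sq_mul (a x y z e : A) : a * (y * z + z * y) * (x * x) * e = 0 := by
  have H := fun t => hid.mul_sq_sq_mul h2 h3 a t x e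
  linear_combination (norm := noncomm_ring) H (y + z) - H y - H z

theorem mul_jordan_jordan_mul (a w x y z e : A) :
    a * (w * x + x * w) * (y * z + z * y) * e = 0 := by
  have H := fun t => hid.mul_sq_jordan_mul h2 h3 a t y z e
  linear_combination (norm := noncomm_ring) H (w + x) - H w - H x

theorem three_mul_sq_mul (a b c x e : A) :
    a * b * c * (x * x) * e = -(e * (x * x) * a * b * c) := by
  have J := hid.mul_sq_jordan_mul h2 h3 e x
  have K := hid.mul_jordan_sq_mul h2 h3 a x
  have h : a * b * c * (x * x) * e + e * (x * x) * a * b * c = 0 := by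
    apply h2
    linear_combination (norm := noncomm_ring)
      hid.jordan_sq_mul h2 h3 (a * b) c x e ⟨a, b, rfl⟩
        - hid.jordan_mul_sq h2 h3 c a b x * e + K c b e
        - J a c b + e * hid.sq_mul_jordan h2 h3 x a b c
  exact eq_neg_of_add_eq_zero_left h

theorem two_mul_sq_mul_two (a d b e f : A) :
    a * d * (b * b) * e * f = 2 • (d * e * f * (b * b) * a) - 2 • (a * d * e * (b * b) * f) := by
  have T := hid.sq_mul h2 b
  linear_combination (norm := noncomm_ring)
    a * T (d * e) * f - hid.mul_jordan_jordan_mul h2 h3 a b d e b f + a * d * T e * f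
      + a * T d * e * f - 2 • hid.three_mul_sq_mul h2 h3 d e f b a

theorem swap_second_of_sq (a b c x e : A) :
    a * b * c * (x * x) * e = -(a * c * b * (x * x) * e) := by
  linear_combination (norm := noncomm_ring) hid.mul_jordan_sq_mul h2 h3 a x b c e

theorem swap_ends_of_sq (a b c x e : A) :
    a * b * c * (x * x) * e = -(e * b * c * (x * x) * a) := by
  have M := fun t => hid.two_mul_sq_mul_two h2 h3 t t x b c
  have Z : ∀ t, t * b * c * (x * x) * t = 0 := by
    intro t
    apply h2
    have h₁ : t * t * (x * x) * b * c = 0 := by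
      linear_combination (norm := noncomm_ring) hid.sq_mul_four h2 h3 t x x b c
    have h₂ : t * t * b * (x * x) * c = 0 := by
      linear_combination (norm := noncomm_ring) hid.sq_mul_four h2 h3 t b x x c
    linear_combination (norm := noncomm_ring) h₁ + 2 • h₂ - M t
  linear_combination (norm := noncomm_ring) Z (a + e) - Z a - Z e

theorem three_mul_sq_mul_eq_zero (a b c x e : A) : a * b * c * (x * x) * e = 0 := by
  have T := hid.sq_mul h2 x
  have C : b * c * e * (x * x) * a = -(a * b * c * (x * x) * e) := by
    linear_combination (norm := noncomm_ring)
      hid.swap_ends_of_sq h2 h3 b c e x a - hid.swap_second_of_sq h2 h3 a c e x b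
        + hid.swap_first h2 h3 a e c x x b - hid.swap_ends_of_sq h2 h3 e a c x b
        + hid.swap_first h2 h3 b a c x x e
  have M := hid.two_mul_sq_mul_two h2 h3 a b x c e
  have N := hid.three_mul_sq_mul h2 h3 b c e x a
  have K := hid.mul_jordan_jordan_mul h2 h3 a x b c x e
  apply h3
  linear_combination (norm := noncomm_ring)
    T (a * b * c) * e - hid.sq_mul_four h2 h3 x a b c e - hid.swap_first h2 h3 x a b c x e
      + K - a * T b * c * e - a * b * T c * e + M + N + C

theorem mul_sq_mul_three_eq_zero (a x b c d : A) : a * (x * x) * b * c * d = 0 := by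
  have h := hid.three_mul_sq_mul h2 h3 b c d x a
  rwa [hid.three_mul_sq_mul_eq_zero h2 h3, eq_comm, neg_eq_zero] at h

theorem two_mul_sq_mul_two_eq_zero (a b x c d : A) : a * b * (x * x) * c * d = 0 := by
  have h := hid.three_mul_sq_mul_eq_zero h2 h3
  rw [hid.two_mul_sq_mul_two h2 h3, h, h, smul_zero, sub_zero]

theorem mul_six_eq_zero (a b c d e f : A) : a * b * c * d * e * f = 0 := by
  have s₂ : ∀ a b c d e f : A, a * b * c * d * e * f = -(a * c * b * d * e * f) := by
    intro a b c d e f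
    have H := fun x => hid.mul_sq_mul_three_eq_zero h2 h3 a x d e f
    linear_combination (norm := noncomm_ring) H (b + c) - H b - H c
  have s₃ : ∀ a b c d e f : A, a * b * c * d * e * f = -(a * b * d * c * e * f) := by
    intro a b c d e f
    have H := fun x => hid.two_mul_sq_mul_two_eq_zero h2 h3 a b x e f
    linear_combination (norm := noncomm_ring) H (c + d) - H c - H d
  have s₄ : ∀ a b c d e f : A, a * b * c * d * e * f = -(a * b * c * e * d * f) := by
    intro a b c d e f
    have H := fun x => hid.three_mul_sq_mul_eq_zero h2 h3 a b c x f
    linear_combination (norm := noncomm_ring) H (d + e) - H d - H e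
  have s₁ := hid.swap_first h2 h3
  have s₅ := hid.swap_last h2 h3
  have left : ∀ a b c d e f : A, a * b * c * d * e * f = c * d * a * b * e * f := by
    intro a b c d e f
    rw [s₂, s₁, s₃, s₂]
    simp only [neg_neg]
  have right : ∀ a b c d e f : A, a * b * c * d * e * f = a * b * e * f * c * d := by
    intro a b c d e f
    rw [s₄, s₃, s₅, s₄]
    simp only [neg_neg]
  apply h2
  apply h3
  linear_combination (norm := noncomm_ring)
    hid (a * b) (c * d) (e * f) + 2 • left a b c d e f + 3 • right a b c d e f
      + right c d a b e f + 2 • left a b e f c d + right e f a b c d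

end SymmetricSumZero


/-- A non-unital associative algebra over a field of characteristic different
from 2 and 3 satisfying the symmetric-sum identity is nilpotent of degree 6. -/
theorem dualAlternative_nilpotent_degree_six
    (F : Type*) [Field F] (hchar2 : (2 : F) ≠ 0) (hchar3 : (3 : F) ≠ 0)
    (A : Type*) [NonUnitalRing A] [Module F A]
    [SMulCommClass F A A] [IsScalarTower F A A]
    (hid : ∀ x y z : A, x * y * z + y * x * z + z * x * y
      + x * z * y + y * z * x + z * y * x = 0) :
    ∀ x₁ x₂ x₃ x₄ x₅ x₆ : A, x₁ * x₂ * x₃ * x₄ * x₅ * x₆ = 0 := by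
  have h2 : ∀ a : A, a + a = 0 → a = 0 := by
    intro a ha
    rw [← two_smul F] at ha
    exact (smul_eq_zero.mp ha).resolve_left hchar2
  have h3 : ∀ a : A, a + a + a = 0 → a = 0 := by
    intro a ha
    have h : (3 : F) • a = 0 := by rw [← ha]; module
    exact (smul_eq_zero.mp h).resolve_left hchar3
  have hs : SymmetricSumZero A := hid
  exact hs.mul_six_eq_zero h2 h3
end

section
/- Let R be a commutative ring, let L be a non-unital nonassociative R-algebra satisfying the linearized right-alternative identity (xy)z + (xz)y = x(yz) + x(zy) and the linearized left-alternative identity (xy)z + (yx)z = x(yz) + y(xz) for all x, y, z ∈ L, and let A be a non-unital associative R-algebra satisfying the symmetric-sum identity abc + bac + cab + acb + bca + cba = 0 for all a, b, c ∈ A. Define, for x, y, z ∈ L and a, b, c ∈ A, the element J(x,a;y,b;z,c) := (xy)z ⊗ (ab)c − z(xy) ⊗ c(ab) − (yx)z ⊗ (ba)c + z(yx) ⊗ c(ba) of the tensor product L ⊗_R A. Then the cyclic sum J(x,a;y,b;z,c) + J(y,b;z,c;x,a) + J(z,c;x,a;y,b) = 0 in L ⊗_R A; equivalently, the bracket [x⊗a,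 y⊗b] = xy⊗ab − yx⊗ba satisfies the Jacobi identity on pure tensors. -/
open scoped TensorProduct

/-- The Jacobi-identity summand `J(x,a;y,b;z,c)` in `L ⊗[R] A`, arising from the
bracket `[x⊗a, y⊗b] = xy⊗ab − yx⊗ba`. -/
noncomputable def jacobiSummand (R : Type*) [CommRing R] (L A : Type*)
    [NonUnitalNonAssocRing L] [Module R L]
    [NonUnitalRing A] [Module R A]
    (x : L) (a : A) (y : L) (b : A) (z : L) (c : A) : L ⊗[R] A :=
  (((x * y) * z) ⊗ₜ[R] ((a * b) * c)) - ((z * (x * y)) ⊗ₜ[R] (c * (a * b)))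
    - (((y * x) * z) ⊗ₜ[R] ((b * a) * c)) + ((z * (y * x)) ⊗ₜ[R] (c * (b * a)))

/-- If `L` is an alternative (non-unital, nonassociative) `R`-algebra and `A` a
dual alternative (non-unital, associative) `R`-algebra, then the bracket
`[x⊗a, y⊗b] = xy⊗ab − yx⊗ba` on `L ⊗[R] A` satisfies the Jacobi identity on
pure tensors. -/
theorem alternative_tensor_dualAlternative_jacobi
    (R : Type*) [CommRing R] (L A : Type*)
    [NonUnitalNonAssocRing L] [Module R L] [SMulCommClass R L L] [IsScalarTower R L L]
    [NonUnitalRing A] [Module R A] [SMulCommClass R A A] [IsScalarTower R A A]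
    (hra : ∀ x y z : L, (x * y) * z + (x * z) * y = x * (y * z) + x * (z * y))
    (hla : ∀ x y z : L, (x * y) * z + (y * x) * z = x * (y * z) + y * (x * z))
    (hA : ∀ a b c : A, a * b * c + b * a * c + c * a * b
      + a * c * b + b * c * a + c * b * a = 0) :
    ∀ (x y z : L) (a b c : A),
      jacobiSummand R L A x a y b z c + jacobiSummand R L A y b z c x a
        + jacobiSummand R L A z c x a y b = 0 := by
  intro x y z a b c
  have right_swap (u v w : L) : associator u w v = -associator u v w := by
    simp only [associator_apply]
    rw [eq_neg_iff_add_eq_zero, ← sub_eq_zero.mpr (hra u v w)]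
    abel
  have left_swap (u v w : L) : associator v u w = -associator u v w := by
    simp only [associator_apply]
    rw [eq_neg_iff_add_eq_zero, ← sub_eq_zero.mpr (hla u v w)]
    abel
  have expand (u v w : L) : (u * v) * w = associator u v w + u * (v * w) := by
    simp only [associator_apply, sub_add_cancel]
  have hyxz : associator y x z = -associator x y z := left_swap x y z
  have hxzy : associator x z y = -associator x y z := right_swap x y z
  have hyzx : associator y z x = associator x y z := by
    rw [right_swap y x z, hyxz, neg_neg]
  have hzxy : associator z x y = associator x y z := by
    rw [left_swap x z y, hxzy, neg_neg]
  have hzyx : associator z y x = -associator x y z := by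
    rw [left_swap y z x, hyzx]
  have key := congrArg (fun d : A => associator x y z ⊗ₜ[R] d) (hA a b c)
  simp only [TensorProduct.tmul_add, TensorProduct.tmul_zero] at key
  simp only [jacobiSummand, expand, hyxz, hxzy, hyzx, hzxy, hzyx,
    TensorProduct.add_tmul, TensorProduct.neg_tmul, ← mul_assoc a, ← mul_assoc b, ← mul_assoc c]
  rw [← key]
  abel
end

section
/- Let R be a commutative ring, let L be a non-unital nonassociative R-algebra satisfying the linearized right-alternative identity (xy)z + (xz)y = x(yz) + x(zy) for all x, y, z ∈ L, and let A be a non-unital associative R-algebra satisfying abc + acb = 0 for all a, b, c ∈ A. Define, for x, y, z ∈ L and a, b, c ∈ A, the element J(x,a;y,b;z,c) := (xy)z ⊗ (ab)c − z(xy) ⊗ c(ab) − (yx)z ⊗ (ba)c + z(yx) ⊗ c(ba) of the tensor product L ⊗_R A. Then the cyclic sum J(x,a;y,b;z,c) + J(y,b;z,c;x,a) + J(z,c;x,a;y,b) = 0 in L ⊗_R A; equivalently, the bracket [x⊗a, y⊗b] = xy⊗ab − yx⊗ba satisfies the Jacobi identity on pure tensors. -/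
open scoped TensorProduct

/-- If `L` is a right-alternative (non-unital, nonassociative) `R`-algebra and
`A` a dual right-alternative (non-unital, associative) `R`-algebra, then the
bracket `[x⊗a, y⊗b] = xy⊗ab − yx⊗ba` on `L ⊗[R] A` satisfies the Jacobi
identity on pure tensors. -/
theorem rightAlternative_tensor_dualRightAlternative_jacobi
    (R : Type*) [CommRing R] (L A : Type*)
    [NonUnitalNonAssocRing L] [Module R L] [SMulCommClass R L L] [IsScalarTower R L L]
    [NonUnitalRing A] [Module R A] [SMulCommClass R A A] [IsScalarTower R A A]
    (hra : ∀ x y z : L, (x * y) * z + (x * z) * y = x * (y * z) + x * (z * y))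
    (hA : ∀ a b c : A, a * b * c + a * c * b = 0) :
    ∀ (x y z : L) (a b c : A),
      jacobiSummand R L A x a y b z c + jacobiSummand R L A y b z c x a
        + jacobiSummand R L A z c x a y b = 0 := by
  intro x y z a b c
  have swap : ∀ u v w : A, u * w * v = -(u * v * w) := fun u v w =>
    eq_neg_of_add_eq_zero_right (hA u v w)
  have tensor : ∀ (u v w : L) (p : A),
      ((u * v) * w) ⊗ₜ[R] p + ((u * w) * v) ⊗ₜ[R] p
        - (u * (v * w)) ⊗ₜ[R] p - (u * (w * v)) ⊗ₜ[R] p = 0 := fun u v w p => by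
    rw [← TensorProduct.add_tmul, hra, TensorProduct.add_tmul]
    abel
  simp only [jacobiSummand, ← mul_assoc a, ← mul_assoc b, ← mul_assoc c]
  rw [swap a b c, swap b a c, swap c a b]
  simp only [TensorProduct.tmul_neg]
  have h : _ - _ + _ = (0 : L ⊗[R] A) :=
    congrArg₂ (· + ·) (congrArg₂ (· - ·) (tensor x y z (a * b * c)) (tensor y x z (b * a * c)))
      (tensor z x y (c * a * b)) |>.trans (by simp)
  rw [← h]
  abel
end

section
/- Let F be the free non-unital associative ℚ-algebra on three generators x, y, z (for instance the semigroup algebra over ℚ of the free semigroup on three generators), and let I be the two-sided ideal of F generated by all elements abc + acb with a, b, c ∈ F. Then in the quotient F/I, the images of the three monomials xyz, zxy, yzx form a basis of the ℚ-subspace spanned by the images of the six multilinear monomials {xyz, yxz, xzy, zxy, yzx, zyx}; in particular, that subspace has dimension 3. -/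
/-- The smallest `R`-submodule of `F` containing `S` and closed under left and
right multiplication by arbitrary elements of `F`: the two-sided ideal of the
(possibly nonassociative, non-unital) algebra `F` generated by `S`, viewed as a
submodule. -/
def idealClosure (R F : Type*) [CommRing R] [AddCommGroup F] [Mul F] [Module R F]
    (S : Set F) : Submodule R F :=
  sInf {p : Submodule R F | S ⊆ p ∧ ∀ a : F, ∀ x ∈ p, a * x ∈ p ∧ x * a ∈ p}

/-- The free non-unital associative `ℚ`-algebra on three generators. -/
abbrev FreeAssoc3 : Type := MonoidAlgebra ℚ (FreeSemigroup (Fin 3))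

/-- The generators of `FreeAssoc3`. -/
noncomputable def gen3 (i : Fin 3) : FreeAssoc3 :=
  MonoidAlgebra.single (FreeSemigroup.of i) 1

/-- The two-sided ideal of `FreeAssoc3` generated by all `abc + acb`. -/
noncomputable def dualRAltIdeal : Submodule ℚ FreeAssoc3 :=
  idealClosure ℚ FreeAssoc3 {w | ∃ a b c : FreeAssoc3, w = a * b * c + a * c * b}

/-- A family of strictly upper triangular matrices closed under addition, scaling and
multiplication, whose triple products are antisymmetric in the last two factors. -/
def antisymmMatrix (a b c p q r s : ℚ) : Matrix (Fin 5) (Fin 5) ℚ :=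
  !![0, a, p, q, r; 0, 0, b, c, s; 0, 0, 0, 0, c; 0, 0, 0, 0, -b; 0, 0, 0, 0, 0]

/-- The range of `antisymmMatrix`, as a non-unital subalgebra. -/
def antisymmMatrixSubalgebra : NonUnitalSubalgebra ℚ (Matrix (Fin 5) (Fin 5) ℚ) where
  carrier := {m | ∃ a b c p q r s, m = antisymmMatrix a b c p q r s}
  add_mem' := by
    rintro _ _ ⟨a, b, c, p, q, r, s, rfl⟩ ⟨a', b', c', p', q', r', s', rfl⟩
    refine ⟨a + a', b + b', c + c', p + p', q + q', r + r', s + s', ?_⟩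
    ext i j
    fin_cases i <;> fin_cases j <;> simp [antisymmMatrix, add_comm]
  zero_mem' := by
    refine ⟨0, 0, 0, 0, 0, 0, 0, ?_⟩
    ext i j
    fin_cases i <;> fin_cases j <;> simp [antisymmMatrix]
  mul_mem' := by
    rintro _ _ ⟨a, b, c, p, q, r, s, rfl⟩ ⟨a', b', c', p', q', r', s', rfl⟩
    refine ⟨0, 0, 0, a * b', a * c', a * s' + p * c' - q * b', b * c' - c * b', ?_⟩
    ext i j
    fin_cases i <;> fin_cases j <;>
      simp [antisymmMatrix, Matrix.mul_apply, Fin.sum_univ_five, sub_eq_add_neg]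
  smul_mem' := by
    rintro t _ ⟨a, b, c, p, q, r, s, rfl⟩
    refine ⟨t * a, t * b, t * c, t * p, t * q, t * r, t * s, ?_⟩
    ext i j
    fin_cases i <;> fin_cases j <;> simp [antisymmMatrix]

lemma mul_mul_add_mul_mul_eq_zero (u v w : antisymmMatrixSubalgebra) :
    u * v * w + u * w * v = 0 := by
  obtain ⟨_, a, b, c, p, q, r, s, rfl⟩ := u
  obtain ⟨_, a', b', c', p', q', r', s', rfl⟩ := v
  obtain ⟨_, a'', b'', c'', p'', q'', r'', s'', rfl⟩ := w
  ext i j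
  fin_cases i <;> fin_cases j <;>
    (simp [antisymmMatrix]; try ring)

/-- The representation of `FreeAssoc3` detecting the multilinear words which start with the
`i`-th generator. -/
noncomputable def antisymmRep (i : Fin 3) : FreeAssoc3 →ₙₐ[ℚ] antisymmMatrixSubalgebra :=
  MonoidAlgebra.liftMagma ℚ (FreeSemigroup.lift fun t =>
    ⟨antisymmMatrix (if t = i then 1 else 0) (if t = i + 1 then 1 else 0)
      (if t = i + 2 then 1 else 0) 0 0 0 0, _, _, _, _, _, _, _, rfl⟩)

lemma coe_antisymmRep_gen3 (i t : Fin 3) :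
    (antisymmRep i (gen3 t) : Matrix (Fin 5) (Fin 5) ℚ) =
      antisymmMatrix (if t = i then 1 else 0) (if t = i + 1 then 1 else 0)
        (if t = i + 2 then 1 else 0) 0 0 0 0 := by
  simp [antisymmRep, gen3]

lemma antisymmRep_eq_zero_of_mem (i : Fin 3) {f : FreeAssoc3} (hf : f ∈ dualRAltIdeal) :
    antisymmRep i f = 0 := by
  have hle : dualRAltIdeal ≤ LinearMap.ker (LinearMapClass.linearMap (antisymmRep i)) := by
    refine sInf_le ⟨?_, fun a x hx => ?_⟩
    · rintro _ ⟨a, b, c, rfl⟩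
      simp [mul_mul_add_mul_mul_eq_zero]
    · simp_all
  simpa using hle hf

lemma mkQ_mul_right_comm (a b c : FreeAssoc3) :
    dualRAltIdeal.mkQ (a * b * c) = -dualRAltIdeal.mkQ (a * c * b) := by
  rw [eq_neg_iff_add_eq_zero, ← map_add, Submodule.mkQ_apply, Submodule.Quotient.mk_eq_zero]
  exact Submodule.mem_sInf.2 fun p hp => hp.1 ⟨a, b, c, rfl⟩

lemma linearIndependent_mkQ_cyclic :
    LinearIndependent ℚ ![dualRAltIdeal.mkQ (gen3 0 * gen3 1 * gen3 2),
      dualRAltIdeal.mkQ (gen3 2 * gen3 0 * gen3 1),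
      dualRAltIdeal.mkQ (gen3 1 * gen3 2 * gen3 0)] := by
  rw [Fintype.linearIndependent_iff]
  intro g hg
  simp only [Fin.sum_univ_three, Matrix.cons_val, ← map_smul, ← map_add] at hg
  rw [Submodule.mkQ_apply, Submodule.Quotient.mk_eq_zero] at hg
  have key (i : Fin 3) := congrArg
    (fun m : antisymmMatrixSubalgebra => (m : Matrix (Fin 5) (Fin 5) ℚ) 0 4)
    (antisymmRep_eq_zero_of_mem i hg)
  simp only [map_add, map_smul, map_mul, NonUnitalSubalgebra.coe_add,
    NonUnitalSubalgebra.coe_smul, NonUnitalSubalgebra.coe_mul, coe_antisymmRep_gen3,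
    NonUnitalSubalgebra.coe_zero] at key
  have h0 := key 0
  have h1 := key 1
  have h2 := key 2
  simp [antisymmMatrix] at h0 h1 h2
  intro i
  fin_cases i <;> assumption

/-- In the quotient of the free non-unital associative `ℚ`-algebra on `x, y, z`
by the ideal generated by all `abc + acb`, the images of `xyz, zxy, yzx` form a
basis of the span of the images of the six multilinear monomials; in
particular that span has dimension 3. -/
theorem dualRAlt_arity_three_dimension :
    let x := gen3 0
    let y := gen3 1
    let z := gen3 2
    let q := dualRAltIdeal.mkQ
    LinearIndependent ℚ ![q (x*y*z), q (z*x*y), q (y*z*x)] ∧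
    Submodule.span ℚ {q (x*y*z), q (z*x*y), q (y*z*x)} =
      Submodule.span ℚ
        {q (x*y*z), q (y*x*z), q (x*z*y), q (z*x*y), q (y*z*x), q (z*y*x)} ∧
    Module.finrank ℚ (Submodule.span ℚ
        ({q (x*y*z), q (y*x*z), q (x*z*y), q (z*x*y), q (y*z*x), q (z*y*x)} :
          Set (FreeAssoc3 ⧸ dualRAltIdeal))) = 3 := by
  intro x y z q
  have hli : LinearIndependent ℚ ![q (x*y*z), q (z*x*y), q (y*z*x)] :=
    linearIndependent_mkQ_cyclic
  have hspan : Submodule.span ℚ {q (x*y*z), q (z*x*y), q (y*z*x)} =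
      Submodule.span ℚ
        {q (x*y*z), q (y*x*z), q (x*z*y), q (z*x*y), q (y*z*x), q (z*y*x)} := by
    apply le_antisymm
    · apply Submodule.span_mono
      rintro _ (rfl | rfl | rfl) <;> simp
    · rw [Submodule.span_le]
      rintro _ (rfl | rfl | rfl | rfl | rfl | rfl)
      · exact Submodule.subset_span (by simp)
      · rw [show q (y*x*z) = _ from mkQ_mul_right_comm y x z]
        exact neg_mem (Submodule.subset_span (by simp [q]))
      · rw [show q (x*z*y) = _ from mkQ_mul_right_comm x z y]
        exact neg_mem (Submodule.subset_span (by simp [q]))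
      · exact Submodule.subset_span (by simp)
      · exact Submodule.subset_span (by simp)
      · rw [show q (z*y*x) = _ from mkQ_mul_right_comm z y x]
        exact neg_mem (Submodule.subset_span (by simp [q]))
  refine ⟨hli, hspan, ?_⟩
  rw [← hspan]
  have hrange : Set.range ![q (x*y*z), q (z*x*y), q (y*z*x)] =
      {q (x*y*z), q (z*x*y), q (y*z*x)} := by
    rw [Matrix.range_cons, Matrix.range_cons_cons_empty]
    rfl
  rw [← hrange, finrank_span_eq_card hli, Fintype.card_fin]
end

section
/- Let F be the free non-unital nonassociative ℚ-algebra on three generators x, y, z (the magma algebra over ℚ of the free magma on three generators), and let I be the two-sided ideal of F generated by all elements (ab)c + (ac)b − a(bc) − a(cb) and (ab)c + (ba)c − a(bc) − b(ac) with a, b, c ∈ F. Then in the quotient F/I, the ℚ-subspace spanned by the images of the twelve multilinear monomials in x, y, z (the six permutations of each of the two bracketings (uv)w and u(vw)) has dimension 7, with basis given by the images of (xy)z, (yx)z, (xz)y, (zx)y, (yz)x, (zy)x, z(xy). -/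
/-- The free non-unital nonassociative `ℚ`-algebra on three generators
(the magma algebra of the free magma on three generators). -/
abbrev FreeNA3 : Type := MonoidAlgebra ℚ (FreeMagma (Fin 3))

/-- The generators of `FreeNA3`. -/
noncomputable def ngen3 (i : Fin 3) : FreeNA3 :=
  MonoidAlgebra.single (FreeMagma.of i) 1

/-- The two-sided ideal of `FreeNA3` generated by the linearized right- and
left-alternative relations. -/
noncomputable def altIdeal3 : Submodule ℚ FreeNA3 :=
  idealClosure ℚ FreeNA3
    ({w | ∃ a b c : FreeNA3, w = (a*b)*c + (a*c)*b - a*(b*c) - a*(c*b)} ∪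
     {w | ∃ a b c : FreeNA3, w = (a*b)*c + (b*a)*c - a*(b*c) - b*(a*c)})

theorem subset_idealClosure (R F : Type*) [CommRing R] [AddCommGroup F] [Mul F] [Module R F]
    (S : Set F) : S ⊆ idealClosure R F S := fun _ hw =>
  (Submodule.mem_sInf).2 fun _ hp => hp.1 hw

/-- The ideal generated by `S` lies in the kernel of every homomorphism that kills `S`. -/
theorem idealClosure_le_ker {R F B : Type*} [CommRing R] [NonUnitalNonAssocRing F] [Module R F]
    [NonUnitalNonAssocRing B] [Module R B] (f : F →ₙₐ[R] B) {S : Set F}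
    (hS : ∀ w ∈ S, f w = 0) : idealClosure R F S ≤ LinearMap.ker (f : F →ₗ[R] B) := by
  refine sInf_le ⟨fun w hw => hS w hw, fun a w hw => ?_⟩
  have hw' : f w = 0 := hw
  exact ⟨show f (a * w) = 0 by rw [map_mul, hw', mul_zero],
    show f (w * a) = 0 by rw [map_mul, hw', zero_mul]⟩

/-- A graded alternative algebra, nilpotent of class three: vectors, 2-tensors, and 3-tensors
together with one extra coordinate that records minus the associator. -/
def AltModel : Type :=
  (Fin 3 → ℚ) × (Fin 3 → Fin 3 → ℚ) × (Fin 3 → Fin 3 → Fin 3 → ℚ) × ℚ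

namespace AltModel

instance : AddCommGroup AltModel :=
  inferInstanceAs (AddCommGroup
    ((Fin 3 → ℚ) × (Fin 3 → Fin 3 → ℚ) × (Fin 3 → Fin 3 → Fin 3 → ℚ) × ℚ))

instance : Module ℚ AltModel :=
  inferInstanceAs (Module ℚ
    ((Fin 3 → ℚ) × (Fin 3 → Fin 3 → ℚ) × (Fin 3 → Fin 3 → Fin 3 → ℚ) × ℚ))

/-- The contraction of a vector and a 2-tensor against the volume form. -/
def contract (a : Fin 3 → ℚ) (n : Fin 3 → Fin 3 → ℚ) : ℚ :=
  a 0 * (n 1 2 - n 2 1) + a 1 * (n 2 0 - n 0 2) + a 2 * (n 0 1 - n 1 0)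

instance : Mul AltModel :=
  ⟨fun u v => (0, fun i j => u.1 i * v.1 j,
    fun i j k => u.2.1 i j * v.1 k + u.1 i * v.2.1 j k, contract u.1 v.2.1)⟩

theorem ext_coord {u v : AltModel} (h₁ : ∀ i, u.1 i = v.1 i) (h₂ : ∀ i j, u.2.1 i j = v.2.1 i j)
    (h₃ : ∀ i j k, u.2.2.1 i j k = v.2.2.1 i j k) (h₄ : u.2.2.2 = v.2.2.2) : u = v :=
  Prod.ext (funext h₁) (Prod.ext (funext fun i => funext (h₂ i))
    (Prod.ext (funext fun i => funext fun j => funext (h₃ i j)) h₄))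

section coordinates

variable (u v : AltModel) (r : ℚ) (i j k : Fin 3)

@[simp] theorem zero_fst : (0 : AltModel).1 i = 0 := rfl
@[simp] theorem zero_snd : (0 : AltModel).2.1 i j = 0 := rfl
@[simp] theorem zero_trd : (0 : AltModel).2.2.1 i j k = 0 := rfl
@[simp] theorem zero_last : (0 : AltModel).2.2.2 = 0 := rfl
@[simp] theorem add_fst : (u + v).1 i = u.1 i + v.1 i := rfl
@[simp] theorem add_snd : (u + v).2.1 i j = u.2.1 i j + v.2.1 i j := rfl
@[simp] theorem add_trd : (u + v).2.2.1 i j k = u.2.2.1 i j k + v.2.2.1 i j k := rfl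
@[simp] theorem add_last : (u + v).2.2.2 = u.2.2.2 + v.2.2.2 := rfl
@[simp] theorem sub_fst : (u - v).1 i = u.1 i - v.1 i := rfl
@[simp] theorem sub_snd : (u - v).2.1 i j = u.2.1 i j - v.2.1 i j := rfl
@[simp] theorem sub_trd : (u - v).2.2.1 i j k = u.2.2.1 i j k - v.2.2.1 i j k := rfl
@[simp] theorem sub_last : (u - v).2.2.2 = u.2.2.2 - v.2.2.2 := rfl
@[simp] theorem smul_fst : (r • u).1 i = r * u.1 i := rfl
@[simp] theorem smul_snd : (r • u).2.1 i j = r * u.2.1 i j := rfl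
@[simp] theorem smul_trd : (r • u).2.2.1 i j k = r * u.2.2.1 i j k := rfl
@[simp] theorem smul_last : (r • u).2.2.2 = r * u.2.2.2 := rfl
@[simp] theorem mul_fst : (u * v).1 i = 0 := rfl
@[simp] theorem mul_snd : (u * v).2.1 i j = u.1 i * v.1 j := rfl
@[simp] theorem mul_trd :
    (u * v).2.2.1 i j k = u.2.1 i j * v.1 k + u.1 i * v.2.1 j k := rfl
@[simp] theorem mul_last : (u * v).2.2.2 = contract u.1 v.2.1 := rfl

end coordinates

instance : NonUnitalNonAssocRing AltModel where
  left_distrib a b c := by apply ext_coord <;> intros <;> simp [contract] <;> ring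
  right_distrib a b c := by apply ext_coord <;> intros <;> simp [contract] <;> ring
  zero_mul a := by apply ext_coord <;> intros <;> simp [contract]
  mul_zero a := by apply ext_coord <;> intros <;> simp [contract]

instance : IsScalarTower ℚ AltModel AltModel where
  smul_assoc r a b := by
    simp only [smul_eq_mul]
    apply ext_coord <;> intros <;> simp [contract] <;> ring

instance : SMulCommClass ℚ AltModel AltModel where
  smul_comm r a b := by
    simp only [smul_eq_mul]
    apply ext_coord <;> intros <;> simp [contract] <;> ring

theorem right_alternative (a b c : AltModel) :
    (a * b) * c + (a * c) * b - a * (b * c) - a * (c * b) = 0 := by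
  apply ext_coord <;> intros <;> simp [contract] <;> ring

theorem left_alternative (a b c : AltModel) :
    (a * b) * c + (b * a) * c - a * (b * c) - b * (a * c) = 0 := by
  apply ext_coord <;> intros <;> simp [contract] <;> ring

/-- The generators of the model. -/
def gen (i : Fin 3) : AltModel := (Pi.single i 1, 0, 0, 0)

@[simp] theorem gen_fst (i j : Fin 3) : (gen i).1 j = if j = i then 1 else 0 :=
  Pi.single_apply i 1 j

@[simp] theorem gen_snd (i j k : Fin 3) : (gen i).2.1 j k = 0 := rfl

/-- The evaluation of nonassociative polynomials in the model. -/
noncomputable def evalHom : FreeNA3 →ₙₐ[ℚ] AltModel :=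
  MonoidAlgebra.liftMagma ℚ (FreeMagma.lift gen)

@[simp] theorem evalHom_ngen3 (i : Fin 3) : evalHom (ngen3 i) = gen i := by
  simp [evalHom, ngen3]

theorem altIdeal3_le_ker : altIdeal3 ≤ LinearMap.ker (evalHom : FreeNA3 →ₗ[ℚ] AltModel) := by
  refine idealClosure_le_ker evalHom ?_
  rintro w (⟨a, b, c, rfl⟩ | ⟨a, b, c, rfl⟩)
  · simpa only [map_sub, map_add, map_mul] using right_alternative (evalHom a) (evalHom b) (evalHom c)
  · simpa only [map_sub, map_add, map_mul] using left_alternative (evalHom a) (evalHom b) (evalHom c)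

end AltModel

theorem mkQ_right_alternative (a b c : FreeNA3) :
    altIdeal3.mkQ ((a * b) * c) + altIdeal3.mkQ ((a * c) * b)
      - altIdeal3.mkQ (a * (b * c)) - altIdeal3.mkQ (a * (c * b)) = 0 := by
  simp only [← map_add, ← map_sub]
  exact (Submodule.Quotient.mk_eq_zero _).2
    (subset_idealClosure _ _ _ (Or.inl ⟨a, b, c, rfl⟩))

theorem mkQ_left_alternative (a b c : FreeNA3) :
    altIdeal3.mkQ ((a * b) * c) + altIdeal3.mkQ ((b * a) * c)
      - altIdeal3.mkQ (a * (b * c)) - altIdeal3.mkQ (b * (a * c)) = 0 := by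
  simp only [← map_add, ← map_sub]
  exact (Submodule.Quotient.mk_eq_zero _).2
    (subset_idealClosure _ _ _ (Or.inr ⟨a, b, c, rfl⟩))

/-- A transposition of the last two factors negates the associator. -/
theorem mkQ_mul_swap_right (a b c : FreeNA3) :
    altIdeal3.mkQ (a * (c * b)) = altIdeal3.mkQ ((a * c) * b)
      + (altIdeal3.mkQ ((a * b) * c) - altIdeal3.mkQ (a * (b * c))) := by
  rw [← sub_eq_zero, ← neg_eq_zero, ← mkQ_right_alternative a b c]
  abel

/-- A transposition of the first two factors negates the associator. -/
theorem mkQ_mul_swap_left (a b c : FreeNA3) :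
    altIdeal3.mkQ (b * (a * c)) = altIdeal3.mkQ ((b * a) * c)
      + (altIdeal3.mkQ ((a * b) * c) - altIdeal3.mkQ (a * (b * c))) := by
  rw [← sub_eq_zero, ← neg_eq_zero, ← mkQ_left_alternative a b c]
  abel

theorem linearIndependent_alt_monomials :
    LinearIndependent ℚ
      (![altIdeal3.mkQ ((ngen3 0 * ngen3 1) * ngen3 2),
        altIdeal3.mkQ ((ngen3 1 * ngen3 0) * ngen3 2),
        altIdeal3.mkQ ((ngen3 0 * ngen3 2) * ngen3 1),
        altIdeal3.mkQ ((ngen3 2 * ngen3 0) * ngen3 1),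
        altIdeal3.mkQ ((ngen3 1 * ngen3 2) * ngen3 0),
        altIdeal3.mkQ ((ngen3 2 * ngen3 1) * ngen3 0),
        altIdeal3.mkQ (ngen3 2 * (ngen3 0 * ngen3 1))] : Fin 7 → FreeNA3 ⧸ altIdeal3) := by
  rw [Fintype.linearIndependent_iff]
  intro g hg
  let φ := altIdeal3.liftQ (AltModel.evalHom : FreeNA3 →ₗ[ℚ] AltModel) AltModel.altIdeal3_le_ker
  have hφ : ∀ w, φ (altIdeal3.mkQ w) = AltModel.evalHom w := fun w => rfl
  have h := congrArg φ hg
  simp [Fin.sum_univ_succ, -Submodule.mkQ_apply, hφ] at h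
  have hc (i j k : Fin 3) := congrArg (fun u : AltModel => u.2.2.1 i j k) h
  have hd := congrArg (fun u : AltModel => u.2.2.2) h
  have h₀ := hc 0 1 2
  have h₁ := hc 1 0 2
  have h₂ := hc 0 2 1
  have h₃ := hc 2 0 1
  have h₄ := hc 1 2 0
  have h₅ := hc 2 1 0
  simp [AltModel.contract] at h₀ h₁ h₂ h₃ h₄ h₅ hd
  rw [hd, add_zero] at h₃
  intro i
  fin_cases i <;> assumption

/-- In the quotient of the free non-unital nonassociative `ℚ`-algebra on
`x, y, z` by the ideal generated by the linearized alternative identities, the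
span of the images of the twelve multilinear monomials has dimension 7, with
basis the images of `(xy)z, (yx)z, (xz)y, (zx)y, (yz)x, (zy)x, z(xy)`. -/
theorem alt_arity_three_dimension :
    let x := ngen3 0
    let y := ngen3 1
    let z := ngen3 2
    let q := altIdeal3.mkQ
    let twelve : Set (FreeNA3 ⧸ altIdeal3) :=
      {q ((x*y)*z), q ((y*x)*z), q ((x*z)*y), q ((z*x)*y), q ((y*z)*x), q ((z*y)*x),
       q (x*(y*z)), q (y*(x*z)), q (x*(z*y)), q (z*(x*y)), q (y*(z*x)), q (z*(y*x))}
    Module.finrank ℚ (Submodule.span ℚ twelve) = 7 ∧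
    LinearIndependent ℚ
      ![q ((x*y)*z), q ((y*x)*z), q ((x*z)*y), q ((z*x)*y), q ((y*z)*x),
        q ((z*y)*x), q (z*(x*y))] ∧
    Submodule.span ℚ
      ({q ((x*y)*z), q ((y*x)*z), q ((x*z)*y), q ((z*x)*y), q ((y*z)*x),
        q ((z*y)*x), q (z*(x*y))} : Set (FreeNA3 ⧸ altIdeal3)) =
      Submodule.span ℚ twelve := by
  intro x y z q twelve
  have hspan : Submodule.span ℚ
      ({q ((x*y)*z), q ((y*x)*z), q ((x*z)*y), q ((z*x)*y), q ((y*z)*x),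
        q ((z*y)*x), q (z*(x*y))} : Set (FreeNA3 ⧸ altIdeal3)) =
      Submodule.span ℚ twelve := by
    refine le_antisymm (Submodule.span_mono ?_) (Submodule.span_le.2 ?_)
    · intro w hw
      simp only [twelve, Set.mem_insert_iff, Set.mem_singleton_iff] at hw ⊢
      tauto
    · set M := Submodule.span ℚ
        ({q ((x*y)*z), q ((y*x)*z), q ((x*z)*y), q ((z*x)*y), q ((y*z)*x),
          q ((z*y)*x), q (z*(x*y))} : Set (FreeNA3 ⧸ altIdeal3))
      have h₁ : q ((x*y)*z) ∈ M := Submodule.subset_span (by simp)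
      have h₂ : q ((y*x)*z) ∈ M := Submodule.subset_span (by simp)
      have h₃ : q ((x*z)*y) ∈ M := Submodule.subset_span (by simp)
      have h₄ : q ((z*x)*y) ∈ M := Submodule.subset_span (by simp)
      have h₅ : q ((y*z)*x) ∈ M := Submodule.subset_span (by simp)
      have h₆ : q ((z*y)*x) ∈ M := Submodule.subset_span (by simp)
      have h₇ : q (z*(x*y)) ∈ M := Submodule.subset_span (by simp)
      have swap_right (a b c : FreeNA3) (h : q ((a*c)*b) ∈ M) (h' : q ((a*b)*c) ∈ M)
          (h'' : q (a*(b*c)) ∈ M) : q (a*(c*b)) ∈ M :=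
        mkQ_mul_swap_right a b c ▸ M.add_mem h (M.sub_mem h' h'')
      have swap_left (a b c : FreeNA3) (h : q ((b*a)*c) ∈ M) (h' : q ((a*b)*c) ∈ M)
          (h'' : q (a*(b*c)) ∈ M) : q (b*(a*c)) ∈ M :=
        mkQ_mul_swap_left a b c ▸ M.add_mem h (M.sub_mem h' h'')
      have hzyx : q (z*(y*x)) ∈ M := swap_right z x y h₆ h₄ h₇
      have hxzy : q (x*(z*y)) ∈ M := swap_left z x y h₃ h₄ h₇
      have hxyz : q (x*(y*z)) ∈ M := swap_right x z y h₁ h₃ hxzy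
      have hyzx : q (y*(z*x)) ∈ M := swap_left z y x h₅ h₆ hzyx
      have hyxz : q (y*(x*z)) ∈ M := swap_left x y z h₂ h₁ hxyz
      rintro w (rfl | rfl | rfl | rfl | rfl | rfl | rfl | rfl | rfl | rfl | rfl | rfl) <;>
        assumption
  refine ⟨?_, linearIndependent_alt_monomials, hspan⟩
  have hrange : ({q ((x*y)*z), q ((y*x)*z), q ((x*z)*y), q ((z*x)*y), q ((y*z)*x),
      q ((z*y)*x), q (z*(x*y))} : Set (FreeNA3 ⧸ altIdeal3)) =
      Set.range ![q ((x*y)*z), q ((y*x)*z), q ((x*z)*y), q ((z*x)*y), q ((y*z)*x),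
        q ((z*y)*x), q (z*(x*y))] := by
    ext w
    simp only [Matrix.range_cons, Matrix.range_empty, Set.union_empty, Set.singleton_union]
  rw [← hspan, hrange]
  exact finrank_span_eq_card linearIndependent_alt_monomials
end

section
/- Let F_n be the free non-unital nonassociative ℚ-algebra on n generators x₁, …, xₙ (the magma algebra over ℚ of the free magma on n generators), and let I be the two-sided ideal of F_n generated by all elements (ab)c + (ac)b − a(bc) − a(cb) with a, b, c ∈ F_n. In the quotient F_n/I, let M_n be the ℚ-subspace spanned by the images of all multilinear monomials in x₁, …, xₙ (all products, in all bracketings, of x_{σ(1)}, …, x_{σ(n)} over all permutations σ). Then dim M₄ = 60 and dim M₅ = 530. -/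
/-- The multiset of variables (with multiplicity) occurring in an element of a
free magma. -/
def FreeMagma.vars {α : Type*} : FreeMagma α → Multiset α
  | .of a => {a}
  | .mul a b => a.vars + b.vars

/-- The free non-unital nonassociative `ℚ`-algebra on `n` generators
(the magma algebra of the free magma on `n` generators). -/
abbrev FreeNA (n : ℕ) : Type := MonoidAlgebra ℚ (FreeMagma (Fin n))

/-- The two-sided ideal of `FreeNA n` generated by the linearized
right-alternative relations. -/
noncomputable def raltIdeal (n : ℕ) : Submodule ℚ (FreeNA n) :=
  idealClosure ℚ (FreeNA n)
    {w | ∃ a b c : FreeNA n, w = (a*b)*c + (a*c)*b - a*(b*c) - a*(c*b)}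

/-- The subspace of the quotient of `FreeNA n` by the right-alternative ideal
spanned by the images of all multilinear monomials in the `n` generators:
the arity-`n` component `RAlt(n)` of the right-alternative operad. -/
noncomputable def raltMultilinSpace (n : ℕ) : Submodule ℚ (FreeNA n ⧸ raltIdeal n) :=
  Submodule.span ℚ ((raltIdeal n).mkQ ''
    {v | ∃ w : FreeMagma (Fin n),
      w.vars = (Finset.univ.val : Multiset (Fin n)) ∧ v = MonoidAlgebra.single w 1})

/-! ### Two-sided ideals -/

section IdealClosure

variable {R F : Type*} [CommRing R] [AddCommGroup F] [Mul F] [Module R F] {S : Set F}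

theorem subset_idealClosure_s11 : S ⊆ idealClosure R F S := fun _ hx =>
  Submodule.mem_sInf.2 fun _ hp => hp.1 hx

theorem idealClosure_le {p : Submodule R F} (hS : S ⊆ p)
    (hmul : ∀ a : F, ∀ x ∈ p, a * x ∈ p ∧ x * a ∈ p) : idealClosure R F S ≤ p :=
  sInf_le ⟨hS, hmul⟩

theorem mul_mem_idealClosure_left (a : F) {x : F} (hx : x ∈ idealClosure R F S) :
    a * x ∈ idealClosure R F S :=
  Submodule.mem_sInf.2 fun p hp => (hp.2 a x (Submodule.mem_sInf.1 hx p hp)).1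

theorem mul_mem_idealClosure_right (a : F) {x : F} (hx : x ∈ idealClosure R F S) :
    x * a ∈ idealClosure R F S :=
  Submodule.mem_sInf.2 fun p hp => (hp.2 a x (Submodule.mem_sInf.1 hx p hp)).2

end IdealClosure

section RaltIdeal

variable {n : ℕ}

theorem raltRelation_mem (a b c : FreeNA n) :
    (a*b)*c + (a*c)*b - a*(b*c) - a*(c*b) ∈ raltIdeal n :=
  subset_idealClosure_s11 ⟨a, b, c, rfl⟩

theorem mul_mem_raltIdeal_left (a : FreeNA n) {x : FreeNA n} (hx : x ∈ raltIdeal n) :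
    a * x ∈ raltIdeal n :=
  mul_mem_idealClosure_left a hx

theorem mul_mem_raltIdeal_right (a : FreeNA n) {x : FreeNA n} (hx : x ∈ raltIdeal n) :
    x * a ∈ raltIdeal n :=
  mul_mem_idealClosure_right a hx

/-- The linearized right Moufang identity holds in every right-alternative algebra in which `2` is
invertible. -/
theorem rightMoufang_mem (x b c d : FreeNA n) :
    ((x*b)*c)*d + ((x*d)*c)*b - x*((b*c)*d) - x*((d*c)*b) ∈ raltIdeal n := by
  let r (u v w : FreeNA n) : FreeNA n := (u*v)*w + (u*w)*v - u*(v*w) - u*(w*v)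
  have hr (u v w) : r u v w ∈ raltIdeal n := raltRelation_mem u v w
  have key : (2 : ℚ) • (((x*b)*c)*d + ((x*d)*c)*b - x*((b*c)*d) - x*((d*c)*b)) =
      r x b c * d + r x d c * b - r x b d * c + r (x*b) c d + r (x*d) c b - r (x*c) b d
        + r x (b*c) d + r x (c*b) d + r x (d*c) b + r x (c*d) b - r x (b*d) c - r x (d*b) c
        - x * r d b c - x * r b c d + x * r c b d := by
    simp only [r, two_smul, mul_add, add_mul, mul_sub, sub_mul]
    abel
  have h2 : (2 : ℚ) • (((x*b)*c)*d + ((x*d)*c)*b - x*((b*c)*d) - x*((d*c)*b)) ∈ raltIdeal n := by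
    rw [key]
    have hl (u v w z) : z * r u v w ∈ raltIdeal n := mul_mem_raltIdeal_left z (hr u v w)
    have hR (u v w z) : r u v w * z ∈ raltIdeal n := mul_mem_raltIdeal_right z (hr u v w)
    clear_value r
    exact add_mem (sub_mem (sub_mem (sub_mem (sub_mem (add_mem (add_mem (add_mem (add_mem
      (sub_mem (add_mem (add_mem (sub_mem (add_mem (hR _ _ _ _) (hR _ _ _ _)) (hR _ _ _ _)) (hr
      _ _ _)) (hr _ _ _)) (hr _ _ _)) (hr _ _ _)) (hr _ _ _)) (hr _ _ _)) (hr _ _ _)) (hr _ _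
      _)) (hr _ _ _)) (hl _ _ _ _)) (hl _ _ _ _)) (hl _ _ _ _)
  exact ((raltIdeal n).smul_mem_iff two_ne_zero).1 h2

/-- The algebra endomorphism of `FreeNA n` permuting the generators. -/
noncomputable def relabel (σ : Equiv.Perm (Fin n)) : FreeNA n →ₙₐ[ℚ] FreeNA n :=
  MonoidAlgebra.mapDomainNonUnitalAlgHom ℚ ℚ (FreeMagma.map σ)

theorem relabel_single (σ : Equiv.Perm (Fin n)) (w : FreeMagma (Fin n)) (r : ℚ) :
    relabel σ (MonoidAlgebra.single w r) = MonoidAlgebra.single (FreeMagma.map σ w) r := by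
  simp [relabel]

theorem relabel_mem_raltIdeal (σ : Equiv.Perm (Fin n)) {x : FreeNA n} (hx : x ∈ raltIdeal n) :
    relabel σ x ∈ raltIdeal n := by
  suffices h : raltIdeal n ≤ (raltIdeal n).comap (relabel σ : FreeNA n →ₗ[ℚ] FreeNA n) from h hx
  refine idealClosure_le ?_ fun a x hx => ?_
  · rintro _ ⟨a, b, c, rfl⟩
    simpa using raltRelation_mem (relabel σ a) (relabel σ b) (relabel σ c)
  · simp only [Submodule.mem_comap, LinearMap.coe_coe, map_mul] at hx ⊢
    exact ⟨mul_mem_raltIdeal_left _ hx, mul_mem_raltIdeal_right _ hx⟩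

end RaltIdeal

/-! ### Words and rewriting -/

namespace FreeMagma

variable {α β : Type*}

/-- The letters of a word, from left to right. -/
def letters : FreeMagma α → List α
  | .of a => [a]
  | .mul a b => a.letters ++ b.letters

/-- The leftmost letter of a word. -/
def leftmost : FreeMagma α → α
  | .of a => a
  | .mul a _ => a.leftmost

@[simp] theorem vars_mul (a b : FreeMagma α) : (a * b).vars = a.vars + b.vars := rfl

@[simp] theorem leftmost_mul (a b : FreeMagma α) : (a * b).leftmost = a.leftmost := rfl

theorem letters_mul (a b : FreeMagma α) : (a * b).letters = a.letters ++ b.letters := rfl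

theorem coe_letters (w : FreeMagma α) : (w.letters : Multiset α) = w.vars := by
  induction w with
  | ih1 a => rfl
  | ih2 a b ha hb => rw [letters_mul, ← Multiset.coe_add, ha, hb, vars_mul]

theorem letters_ne_nil (w : FreeMagma α) : w.letters ≠ [] := by
  induction w with
  | ih1 a => simp [letters]
  | ih2 a b ha hb => simp [letters_mul, ha]

theorem head?_letters (w : FreeMagma α) : w.letters.head? = some w.leftmost := by
  induction w with
  | ih1 a => rfl
  | ih2 a b ha hb => simp [letters_mul, ha]

theorem vars_map (f : α → β) (w : FreeMagma α) : (map f w).vars = w.vars.map f := by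
  induction w with
  | ih1 a => rfl
  | ih2 a b ha hb => simp [ha, hb]

theorem vars_map_perm {n : ℕ} (σ : Equiv.Perm (Fin n)) {w : FreeMagma (Fin n)}
    (h : w.vars = Finset.univ.val) : (map σ w).vars = Finset.univ.val := by
  rw [vars_map, h, ← Equiv.coe_toEmbedding, ← Finset.map_val, Finset.univ_map_equiv_to_embedding]

theorem leftmost_map (f : α → β) (w : FreeMagma α) : (map f w).leftmost = f w.leftmost := by
  induction w with
  | ih1 a => rfl
  | ih2 a b ha hb => simp [ha]

theorem map_swap_swap [DecidableEq α] (i j : α) (w : FreeMagma α) :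
    map (Equiv.swap i j) (map (Equiv.swap i j) w) = w := by
  induction w with
  | ih1 a => simp
  | ih2 a b ha hb => simp [ha, hb]

/-- All words with the given sequence of letters, of length at most the first argument. -/
def bracketings : ℕ → List α → List (FreeMagma α)
  | 0, _ => []
  | _ + 1, [] => []
  | _ + 1, [a] => [of a]
  | k + 1, l => (List.range' 1 (l.length - 1)).flatMap fun i =>
      (bracketings k (l.take i)).flatMap fun a => (bracketings k (l.drop i)).map (a * ·)

theorem mem_bracketings_letters (w : FreeMagma α) (k : ℕ) (hk : w.letters.length ≤ k) :
    w ∈ bracketings k w.letters := by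
  induction w generalizing k with
  | ih1 a =>
    cases k with
    | zero => simp [letters] at hk
    | succ k => simp [letters, bracketings]
  | ih2 a b ha hb =>
    have hla := List.length_pos_iff.2 a.letters_ne_nil
    have hlb := List.length_pos_iff.2 b.letters_ne_nil
    rw [letters_mul, List.length_append] at hk
    cases k with
    | zero => omega
    | succ k =>
      rw [letters_mul, bracketings]
      · refine List.mem_flatMap.2 ⟨a.letters.length, ?_, List.mem_flatMap.2 ⟨a, ?_, ?_⟩⟩
        · rw [List.mem_range'_1, List.length_append]
          omega
        · rw [List.take_left]
          exact ha k (by omega)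
        · rw [List.drop_left]
          exact List.mem_map.2 ⟨b, hb k (by omega), rfl⟩
      · intro h
        have := congrArg List.length h
        rw [List.length_append] at this
        simp only [List.length_nil] at this
        omega
      · intro c h
        have := congrArg List.length h
        rw [List.length_append] at this
        simp only [List.length_singleton] at this
        omega

theorem letters_of_mem_bracketings {k : ℕ} {l : List α} {w : FreeMagma α}
    (h : w ∈ bracketings k l) : w.letters = l := by
  induction k generalizing l w with
  | zero => simp [bracketings] at h
  | succ k ih =>
    rcases l with _ | ⟨a, _ | ⟨b, l⟩⟩
    · simp [bracketings] at h
    · rw [List.mem_singleton.1 h]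
      rfl
    · rw [bracketings] at h
      · simp only [List.mem_flatMap, List.mem_map] at h
        obtain ⟨i, -, u, hu, v, hv, rfl⟩ := h
        rw [letters_mul, ih hu, ih hv, List.take_append_drop]
      all_goals simp

/-- `x(bc) = (xb)c + (xc)b - x(cb)`. -/
def raltExpand (x : FreeMagma α) : FreeMagma α → List (FreeMagma α × FreeMagma α × FreeMagma α)
  | .mul b c => [(x*b*c, x*c*b, x*(c*b))]
  | .of _ => []

/-- `(xb)c = x(bc) + x(cb) - (xc)b`. -/
def raltContract (c : FreeMagma α) : FreeMagma α → List (FreeMagma α × FreeMagma α × FreeMagma α)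
  | .mul x b => [(x*(b*c), x*(c*b), x*c*b)]
  | .of _ => []

/-- `x((bc)d) = ((xb)c)d + ((xd)c)b - x((dc)b)`. -/
def moufangExpand (x : FreeMagma α) :
    FreeMagma α → List (FreeMagma α × FreeMagma α × FreeMagma α)
  | .mul (.mul b c) d => [(x*b*c*d, x*d*c*b, x*(d*c*b))]
  | _ => []

/-- `((xb)c)d = x((bc)d) + x((dc)b) - ((xd)c)b`. -/
def moufangContract (d : FreeMagma α) :
    FreeMagma α → List (FreeMagma α × FreeMagma α × FreeMagma α)
  | .mul (.mul x b) c => [(x*(b*c*d), x*(d*c*b), x*d*c*b)]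
  | _ => []

/-- The triples `(p, q, r)` for which `w = p + q - r` is obtained by applying the linearized
right-alternative or right Moufang identity to a subword of `w`. -/
def rewrites : FreeMagma α → List (FreeMagma α × FreeMagma α × FreeMagma α)
  | .of _ => []
  | .mul x y =>
    raltExpand x y ++ raltContract y x ++ moufangExpand x y ++ moufangContract y x ++
      (rewrites x).map (fun t => (t.1 * y, t.2.1 * y, t.2.2 * y)) ++
      (rewrites y).map (fun t => (x * t.1, x * t.2.1, x * t.2.2))

theorem rewrites_mul (x y : FreeMagma α) : rewrites (x * y) =
    raltExpand x y ++ raltContract y x ++ moufangExpand x y ++ moufangContract y x ++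
      (rewrites x).map (fun t => (t.1 * y, t.2.1 * y, t.2.2 * y)) ++
      (rewrites y).map (fun t => (x * t.1, x * t.2.1, x * t.2.2)) := rfl

theorem rewrites_induction
    {C : FreeMagma α → FreeMagma α → FreeMagma α → FreeMagma α → Prop}
    (ralt_expand : ∀ x b c, C (x*(b*c)) (x*b*c) (x*c*b) (x*(c*b)))
    (ralt_contract : ∀ x b c, C (x*b*c) (x*(b*c)) (x*(c*b)) (x*c*b))
    (moufang_expand : ∀ x b c d, C (x*(b*c*d)) (x*b*c*d) (x*d*c*b) (x*(d*c*b)))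
    (moufang_contract : ∀ x b c d, C (x*b*c*d) (x*(b*c*d)) (x*(d*c*b)) (x*d*c*b))
    (mul_right : ∀ w p q r y, C w p q r → C (w*y) (p*y) (q*y) (r*y))
    (mul_left : ∀ x w p q r, C w p q r → C (x*w) (x*p) (x*q) (x*r))
    {w p q r : FreeMagma α} (h : (p, q, r) ∈ rewrites w) : C w p q r := by
  induction w generalizing p q r with
  | ih1 a => simp [rewrites] at h
  | ih2 x y hx hy =>
    simp only [rewrites_mul, List.mem_append, List.mem_map, Prod.mk.injEq, Prod.exists] at h
    rcases h with ((((h | h) | h) | h) | ⟨p, q, r, h, rfl, rfl, rfl⟩) | ⟨p, q, r, h, rfl, rfl, rfl⟩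
    · rcases y with _ | ⟨b, c⟩
      · simp [raltExpand] at h
      · simp only [raltExpand, List.mem_singleton, Prod.mk.injEq] at h
        obtain ⟨rfl, rfl, rfl⟩ := h
        exact ralt_expand _ _ _
    · rcases x with _ | ⟨x, b⟩
      · simp [raltContract] at h
      · simp only [raltContract, List.mem_singleton, Prod.mk.injEq] at h
        obtain ⟨rfl, rfl, rfl⟩ := h
        exact ralt_contract _ _ _
    · rcases y with _ | ⟨_ | ⟨b, c⟩, d⟩
      · simp [moufangExpand] at h
      · simp [moufangExpand] at h
      · simp only [moufangExpand, List.mem_singleton, Prod.mk.injEq] at h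
        obtain ⟨rfl, rfl, rfl⟩ := h
        exact moufang_expand _ _ _ _
    · rcases x with _ | ⟨_ | ⟨x, b⟩, c⟩
      · simp [moufangContract] at h
      · simp [moufangContract] at h
      · simp only [moufangContract, List.mem_singleton, Prod.mk.injEq] at h
        obtain ⟨rfl, rfl, rfl⟩ := h
        exact moufang_contract _ _ _ _
    · exact mul_right _ _ _ _ _ (hx h)
    · exact mul_left _ _ _ _ _ (hy h)

theorem raltContract_mem_rewrites (x b c : FreeMagma α) :
    (x*(b*c), x*(c*b), x*c*b) ∈ rewrites (x*b*c) := by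
  rw [rewrites_mul]
  simp only [List.mem_append]
  exact .inl (.inl (.inl (.inl (.inr (List.mem_singleton_self _)))))

theorem mul_right_mem_rewrites {w p q r : FreeMagma α} (h : (p, q, r) ∈ rewrites w)
    (y : FreeMagma α) : (p*y, q*y, r*y) ∈ rewrites (w*y) := by
  rw [rewrites_mul]
  simp only [List.mem_append]
  exact .inl (.inr (List.mem_map.2 ⟨_, h, rfl⟩))

theorem mul_left_mem_rewrites {w p q r : FreeMagma α} (h : (p, q, r) ∈ rewrites w)
    (x : FreeMagma α) : (x*p, x*q, x*r) ∈ rewrites (x*w) := by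
  rw [rewrites_mul]
  exact List.mem_append_right _ (List.mem_map.2 ⟨_, h, rfl⟩)

theorem vars_leftmost_of_mem_rewrites {w p q r : FreeMagma α} (h : (p, q, r) ∈ rewrites w) :
    (p.vars = w.vars ∧ p.leftmost = w.leftmost) ∧ (q.vars = w.vars ∧ q.leftmost = w.leftmost) ∧
      (r.vars = w.vars ∧ r.leftmost = w.leftmost) := by
  refine rewrites_induction (C := fun w p q r =>
    (p.vars = w.vars ∧ p.leftmost = w.leftmost) ∧ (q.vars = w.vars ∧ q.leftmost = w.leftmost) ∧
      (r.vars = w.vars ∧ r.leftmost = w.leftmost)) ?_ ?_ ?_ ?_ ?_ ?_ h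
  · intro x b c
    simp [add_comm, add_left_comm]
  · intro x b c
    simp [add_comm, add_left_comm]
  · intro x b c d
    simp [add_comm, add_left_comm]
  · intro x b c d
    simp [add_comm, add_left_comm]
  · rintro w p q r y ⟨⟨h1, h2⟩, ⟨h3, h4⟩, ⟨h5, h6⟩⟩
    simp [*]
  · rintro x w p q r ⟨⟨h1, h2⟩, ⟨h3, h4⟩, ⟨h5, h6⟩⟩
    simp [*]

end FreeMagma

section Rewriting

variable {n : ℕ}

local notation "δ" => fun w : FreeMagma (Fin n) => (MonoidAlgebra.single w (1 : ℚ) : FreeNA n)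

theorem single_sub_mem_raltIdeal {w p q r : FreeMagma (Fin n)}
    (h : (p, q, r) ∈ w.rewrites) : δ w - δ p - δ q + δ r ∈ raltIdeal n := by
  have hmul (u v : FreeMagma (Fin n)) : δ (u * v) = δ u * δ v := by simp
  refine FreeMagma.rewrites_induction (C := fun w p q r => δ w - δ p - δ q + δ r ∈ raltIdeal n)
    ?_ ?_ ?_ ?_ ?_ ?_ h
  · intro x b c
    convert neg_mem (raltRelation_mem (δ x) (δ b) (δ c)) using 1
    simp only [hmul]
    abel
  · intro x b c
    convert raltRelation_mem (δ x) (δ b) (δ c) using 1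
    simp only [hmul]
    abel
  · intro x b c d
    convert neg_mem (rightMoufang_mem (δ x) (δ b) (δ c) (δ d)) using 1
    simp only [hmul]
    abel
  · intro x b c d
    convert rightMoufang_mem (δ x) (δ b) (δ c) (δ d) using 1
    simp only [hmul]
    abel
  · intro w p q r y h
    convert mul_mem_raltIdeal_right (δ y) h using 1
    simp only [hmul, add_mul, sub_mul]
  · intro x w p q r h
    convert mul_mem_raltIdeal_left (δ x) h using 1
    simp only [hmul, mul_add, mul_sub]

theorem raltIdeal_le_span : raltIdeal n ≤ Submodule.span ℚ
    {v | ∃ w p q r : FreeMagma (Fin n), (p, q, r) ∈ w.rewrites ∧ v = δ w - δ p - δ q + δ r} := by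
  set J := Submodule.span ℚ
    {v | ∃ w p q r : FreeMagma (Fin n), (p, q, r) ∈ w.rewrites ∧ v = δ w - δ p - δ q + δ r}
  have hgen {w p q r : FreeMagma (Fin n)} (h : (p, q, r) ∈ w.rewrites) :
      δ w - δ p - δ q + δ r ∈ J := Submodule.subset_span ⟨w, p, q, r, h, rfl⟩
  refine idealClosure_le ?_ fun a x hx => ?_
  · rintro _ ⟨a, b, c, rfl⟩
    rw [SetLike.mem_coe]
    induction a using MonoidAlgebra.induction_linear with
    | zero => simp
    | add a a' h h' =>
      convert add_mem h h' using 1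
      simp only [add_mul]
      abel
    | single u s =>
      induction b using MonoidAlgebra.induction_linear with
      | zero => simp
      | add b b' h h' =>
        convert add_mem h h' using 1
        simp only [add_mul, mul_add]
        abel
      | single v s' =>
        induction c using MonoidAlgebra.induction_linear with
        | zero => simp
        | add c c' h h' =>
          convert add_mem h h' using 1
          simp only [add_mul, mul_add]
          abel
        | single w s'' =>
          convert J.smul_mem (s * s' * s'') (hgen (FreeMagma.raltContract_mem_rewrites u v w))
            using 1
          simp only [MonoidAlgebra.single_mul_single, smul_sub, smul_add,
            MonoidAlgebra.smul_single', mul_one, mul_comm s'' s', mul_right_comm s s'' s',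
            ← mul_assoc]
          abel
  · induction a using MonoidAlgebra.induction_linear with
    | zero => simp
    | add a a' h h' =>
      rw [add_mul, mul_add]
      exact ⟨add_mem h.1 h'.1, add_mem h.2 h'.2⟩
    | single u s =>
      induction hx using Submodule.span_induction with
      | zero => simp
      | add x y _ _ h h' =>
        rw [add_mul, mul_add]
        exact ⟨add_mem h.1 h'.1, add_mem h.2 h'.2⟩
      | smul t x _ h =>
        rw [mul_smul_comm, smul_mul_assoc]
        exact ⟨J.smul_mem t h.1, J.smul_mem t h.2⟩
      | mem x h =>
        obtain ⟨w, p, q, r, h, rfl⟩ := h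
        constructor
        · convert J.smul_mem s (hgen (FreeMagma.mul_left_mem_rewrites h u)) using 1
          simp only [mul_add, mul_sub, smul_add, smul_sub, MonoidAlgebra.single_mul_single,
            MonoidAlgebra.smul_single', mul_one]
        · convert J.smul_mem s (hgen (FreeMagma.mul_right_mem_rewrites h u)) using 1
          simp only [add_mul, sub_mul, smul_add, smul_sub, MonoidAlgebra.single_mul_single,
            MonoidAlgebra.smul_single', mul_one, one_mul]

end Rewriting

/-! ### Certificates for the dimension -/

section Certificate

variable {n : ℕ} [NeZero n]

local notation "δ" => fun w : FreeMagma (Fin n) => (MonoidAlgebra.single w (1 : ℚ) : FreeNA n)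

/-- A multilinear word starting with the first generator. -/
def FreeMagma.IsRooted (w : FreeMagma (Fin n)) : Prop :=
  w.vars = Finset.univ.val ∧ w.leftmost = 0

theorem FreeMagma.IsRooted.of_mem_rewrites {w p q r : FreeMagma (Fin n)} (hw : w.IsRooted)
    (h : (p, q, r) ∈ w.rewrites) : p.IsRooted ∧ q.IsRooted ∧ r.IsRooted := by
  obtain ⟨⟨h1, h2⟩, ⟨h3, h4⟩, ⟨h5, h6⟩⟩ := vars_leftmost_of_mem_rewrites h
  exact ⟨⟨h1.trans hw.1, h2.trans hw.2⟩, ⟨h3.trans hw.1, h4.trans hw.2⟩,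
    ⟨h5.trans hw.1, h6.trans hw.2⟩⟩

theorem FreeMagma.isRooted_iff_of_mem_rewrites {w p q r : FreeMagma (Fin n)}
    (h : (p, q, r) ∈ w.rewrites) :
    (p.IsRooted ↔ w.IsRooted) ∧ (q.IsRooted ↔ w.IsRooted) ∧ (r.IsRooted ↔ w.IsRooted) := by
  obtain ⟨⟨h1, h2⟩, ⟨h3, h4⟩, ⟨h5, h6⟩⟩ := vars_leftmost_of_mem_rewrites h
  simp [IsRooted, *]

open Classical in
/-- The linear extension of a function on the words starting with the first generator. -/
noncomputable def coordMap {d : ℕ} (coord : FreeMagma (Fin n) → Fin d → ℚ) :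
    FreeNA n →ₗ[ℚ] Fin d → ℚ :=
  Finsupp.linearCombination ℚ (fun w => if w.IsRooted then coord w else 0) ∘ₗ
    (MonoidAlgebra.coeffLinearEquiv ℚ).toLinearMap

open Classical in
theorem coordMap_single {d : ℕ} (coord : FreeMagma (Fin n) → Fin d → ℚ) (w : FreeMagma (Fin n)) :
    coordMap coord (δ w) = if w.IsRooted then coord w else 0 := by
  simp [coordMap]

theorem coordMap_eq_zero {d : ℕ} {coord : FreeMagma (Fin n) → Fin d → ℚ}
    (hrel : ∀ w p q r : FreeMagma (Fin n), w.IsRooted → (p, q, r) ∈ w.rewrites →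
      coord w + coord r = coord p + coord q) {x : FreeNA n} (hx : x ∈ raltIdeal n) :
    coordMap coord x = 0 := by
  suffices h : raltIdeal n ≤ LinearMap.ker (coordMap coord) from h hx
  refine raltIdeal_le_span.trans (Submodule.span_le.2 ?_)
  rintro _ ⟨w, p, q, r, h, rfl⟩
  obtain ⟨hp, hq, hr⟩ := FreeMagma.isRooted_iff_of_mem_rewrites h
  rw [SetLike.mem_coe, LinearMap.mem_ker, map_add, map_sub, map_sub]
  by_cases hw : w.IsRooted
  · simp only [coordMap_single, hp, hq, hr, hw, if_true]
    rw [sub_sub, sub_add_eq_add_sub, hrel w p q r hw h, sub_self]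
  · simp [coordMap_single, hp, hq, hr, hw]

/-- A system of coordinates compatible with all rewriting steps, together with a descent of all
words to words with unit coordinate vectors, determines the dimension. -/
theorem finrank_raltMultilinSpace {d : ℕ} (coord : FreeMagma (Fin n) → Fin d → ℚ)
    (level : FreeMagma (Fin n) → ℕ) (basis : Fin d → FreeMagma (Fin n))
    (hbasis : ∀ k, (basis k).IsRooted ∧ coord (basis k) = Pi.single k 1)
    (hrel : ∀ w p q r : FreeMagma (Fin n), w.IsRooted → (p, q, r) ∈ w.rewrites →
      coord w + coord r = coord p + coord q)
    (hdescent : ∀ w : FreeMagma (Fin n), w.IsRooted → w ∈ Set.range basis ∨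
      ∃ t ∈ w.rewrites, level t.1 < level w ∧ level t.2.1 < level w ∧ level t.2.2 < level w) :
    Module.finrank ℚ (raltMultilinSpace n) = n * d := by
  let u (x : Fin n × Fin d) : FreeMagma (Fin n) :=
    FreeMagma.map (Equiv.swap 0 x.1) (basis x.2)
  let v (x : Fin n × Fin d) : FreeNA n ⧸ raltIdeal n := (raltIdeal n).mkQ (δ (u x))
  have hu (x) : (u x).leftmost = x.1 := by
    simp [u, FreeMagma.leftmost_map, (hbasis x.2).1.2]
  -- linear independence
  let f : FreeNA n →ₗ[ℚ] Fin n → Fin d → ℚ :=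
    LinearMap.pi fun i => coordMap coord ∘ₗ (relabel (Equiv.swap 0 i) : FreeNA n →ₗ[ℚ] FreeNA n)
  have hf : raltIdeal n ≤ LinearMap.ker f := fun x hx => by
    rw [LinearMap.mem_ker]
    funext i
    exact coordMap_eq_zero hrel (relabel_mem_raltIdeal _ hx)
  let g := (LinearEquiv.curry ℚ ℚ (Fin n) (Fin d)).symm.toLinearMap ∘ₗ (raltIdeal n).liftQ f hf
  have hg (x) : g (v x) = Pi.single x 1 := by
    funext ⟨i, k⟩
    have : g (v x) (i, k) = coordMap coord (relabel (Equiv.swap 0 i) (δ (u x))) k := rfl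
    rw [this, relabel_single, coordMap_single]
    by_cases hi : i = x.1
    · subst hi
      rw [FreeMagma.map_swap_swap, if_pos (hbasis _).1, (hbasis _).2]
      simp [Pi.single_apply, Prod.ext_iff]
    · rw [if_neg]
      · simp [Prod.ext_iff, hi]
      · intro h
        have := h.2
        rw [FreeMagma.leftmost_map, hu, Equiv.swap_apply_eq_iff, Equiv.swap_apply_left] at this
        exact hi this.symm
  have hv : LinearIndependent ℚ v := by
    refine LinearIndependent.of_comp g ?_
    have : g ∘ v = Pi.basisFun ℚ (Fin n × Fin d) := by
      funext x
      simp [hg]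
    rw [this]
    exact (Pi.basisFun ℚ _).linearIndependent
  -- spanning
  have hroot (m : ℕ) : ∀ w : FreeMagma (Fin n), w.IsRooted → level w = m →
      δ w ∈ Submodule.span ℚ (Set.range fun k => δ (basis k)) ⊔ raltIdeal n := by
    induction m using Nat.strong_induction_on with
    | _ m ih =>
      rintro w hw rfl
      rcases hdescent w hw with ⟨k, rfl⟩ | ⟨⟨p, q, r⟩, h, hp, hq, hr⟩
      · exact Submodule.mem_sup_left (Submodule.subset_span ⟨k, rfl⟩)
      · obtain ⟨hp', hq', hr'⟩ := hw.of_mem_rewrites h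
        have := add_mem (Submodule.mem_sup_right (single_sub_mem_raltIdeal h))
          (sub_mem (add_mem (ih _ hp _ hp' rfl) (ih _ hq _ hq' rfl)) (ih _ hr _ hr' rfl))
        convert this using 1
        abel
  have hspan : raltMultilinSpace n = Submodule.span ℚ (Set.range v) := by
    refine le_antisymm (Submodule.span_le.2 ?_) (Submodule.span_le.2 ?_)
    · rintro _ ⟨_, ⟨w, hw, rfl⟩, rfl⟩
      set σ := Equiv.swap 0 w.leftmost with hσ
      have h1 : (FreeMagma.map σ w).IsRooted :=
        ⟨FreeMagma.vars_map_perm σ hw, by rw [FreeMagma.leftmost_map, hσ, Equiv.swap_apply_right]⟩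
      have h2 : Submodule.span ℚ (Set.range fun k => δ (basis k)) ⊔ raltIdeal n ≤
          (Submodule.span ℚ (Set.range v)).comap
            ((raltIdeal n).mkQ ∘ₗ (relabel σ : FreeNA n →ₗ[ℚ] FreeNA n)) := by
        refine sup_le (Submodule.span_le.2 ?_) fun x hx => ?_
        · rintro _ ⟨k, rfl⟩
          refine Submodule.subset_span ⟨(w.leftmost, k), ?_⟩
          simp only [v, u, LinearMap.comp_apply, LinearMap.coe_coe, relabel_single, hσ]
        · have : (raltIdeal n).mkQ (relabel σ x) = 0 := by
            simpa using relabel_mem_raltIdeal σ hx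
          rw [Submodule.mem_comap, LinearMap.comp_apply, LinearMap.coe_coe, this]
          exact zero_mem _
      have h3 := h2 (hroot _ _ h1 rfl)
      rwa [Submodule.mem_comap, LinearMap.comp_apply, LinearMap.coe_coe, relabel_single, hσ,
        FreeMagma.map_swap_swap] at h3
    · rintro _ ⟨x, rfl⟩
      exact Submodule.subset_span
        ⟨_, ⟨u x, FreeMagma.vars_map_perm _ (hbasis x.2).1.1, rfl⟩, rfl⟩
  rw [hspan, finrank_span_eq_card hv]
  simp

end Certificate

/-! ### Coordinates in packed form -/

section Packed

theorem add_div_pow_mod_sixteen {d : ℕ} {a b : ℕ} (ha : ∀ i < d, a / 16 ^ i % 16 < 8)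
    (hb : ∀ i < d, b / 16 ^ i % 16 < 8) {i : ℕ} (hi : i < d) :
    (a + b) / 16 ^ i % 16 = a / 16 ^ i % 16 + b / 16 ^ i % 16 := by
  induction i generalizing a b d with
  | zero =>
    have := ha 0 hi
    have := hb 0 hi
    simp only [pow_zero, Nat.div_one] at *
    omega
  | succ i ih =>
    have h1 := ha 0 (by omega)
    have h2 := hb 0 (by omega)
    simp only [pow_zero, Nat.div_one] at h1 h2
    have hd (x j : ℕ) : x / 16 ^ (j + 1) = x / 16 / 16 ^ j := by
      rw [pow_succ', Nat.div_div_eq_div_mul]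
    have hab : (a + b) / 16 = a / 16 + b / 16 := by omega
    rw [hd, hd, hd, hab]
    refine ih (d := d - 1) (fun j hj => ?_) (fun j hj => ?_) (by omega)
    · rw [← hd]
      exact ha _ (by omega)
    · rw [← hd]
      exact hb _ (by omega)

theorem div_pow_mod_sixteen_lt {a b i : ℕ} (h : a &&& b = 0) (hb : b / 16 ^ i % 16 = 8) :
    a / 16 ^ i % 16 < 8 := by
  have h16 : 16 ^ i = 2 ^ (4 * i) := by
    rw [pow_mul]
    norm_num
  have key : (a / 16 ^ i % 2 ^ 4) &&& (b / 16 ^ i % 2 ^ 4) = 0 := by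
    rw [← Nat.and_mod_two_pow, h16, ← Nat.and_div_two_pow, h, Nat.zero_div, Nat.zero_mod]
  norm_num only at key
  rw [hb] at key
  have hlt : a / 16 ^ i % 16 < 16 := Nat.mod_lt _ (by norm_num)
  generalize a / 16 ^ i % 16 = x at *
  interval_cases x <;> simp_all

variable {n : ℕ} [NeZero n]

/-- The multilinear words starting with the first generator. -/
def rootedWords (n : ℕ) [NeZero n] : List (FreeMagma (Fin n)) :=
  (List.finRange n).tail.permutations'.flatMap fun l => FreeMagma.bracketings n (0 :: l)

theorem mem_rootedWords {w : FreeMagma (Fin n)} : w ∈ rootedWords n ↔ w.IsRooted := by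
  have hperm (w : FreeMagma (Fin n)) :
      w.letters.Perm (List.finRange n) ↔ w.vars = Finset.univ.val := by
    rw [← FreeMagma.coe_letters, ← Multiset.coe_eq_coe]
    rfl
  have hcons : List.finRange n = 0 :: (List.finRange n).tail := by
    cases n with
    | zero => exact absurd rfl (NeZero.ne 0)
    | succ n => rw [List.finRange_succ, List.tail_cons]
  rw [rootedWords, List.mem_flatMap]
  simp only [List.mem_permutations']
  constructor
  · rintro ⟨l, hl, hw⟩
    have hw := FreeMagma.letters_of_mem_bracketings hw
    refine ⟨(hperm w).1 ?_, ?_⟩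
    · rw [hw, hcons]
      exact hl.cons 0
    · have := w.head?_letters
      rw [hw, List.head?_cons, Option.some_inj] at this
      exact this.symm
  · rintro ⟨h1, h2⟩
    have h := (hperm w).2 h1
    have hw : w.letters = 0 :: w.letters.tail :=
      List.eq_cons_of_mem_head? (by rw [FreeMagma.head?_letters, h2]; rfl)
    refine ⟨w.letters.tail, ?_, ?_⟩
    · rw [hw, hcons] at h
      exact h.cons_inv
    · rw [← hw]
      refine FreeMagma.mem_bracketings_letters w n ?_
      rw [h.length_eq, List.length_finRange]

/-- `finrank_raltMultilinSpace` with a coordinate vector stored as a single number, whose digit in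
base `16` at position `i` exceeds the `i`-th coordinate by `2`. -/
theorem finrank_raltMultilinSpace_of_packed (d : ℕ) (coord level : FreeMagma (Fin n) → ℕ)
    (hword : ∀ w ∈ rootedWords n, coord w &&& (16 ^ d - 1) / 15 * 8 = 0 ∧
      (∀ t ∈ w.rewrites, coord w + coord t.2.2 = coord t.1 + coord t.2.1) ∧
      (level w = 0 ∨ ∃ t ∈ w.rewrites,
        level t.1 < level w ∧ level t.2.1 < level w ∧ level t.2.2 < level w))
    (hbasis : ((rootedWords n).filter (level · = 0)).map coord =
      (List.range d).map fun k => (16 ^ d - 1) / 15 * 2 + 16 ^ k)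
    (hdigit : ∀ i < d, (16 ^ d - 1) / 15 * 8 / 16 ^ i % 16 = 8)
    (hunit : ∀ k < d, ∀ i < d,
      ((16 ^ d - 1) / 15 * 2 + 16 ^ k) / 16 ^ i % 16 = if i = k then 3 else 2) :
    Module.finrank ℚ (raltMultilinSpace n) = n * d := by
  have hsmall (w) (hw : w ∈ rootedWords n) (i) (hi : i < d) : coord w / 16 ^ i % 16 < 8 :=
    div_pow_mod_sixteen_lt (hword w hw).1 (hdigit i hi)
  set B := (rootedWords n).filter (level · = 0)
  have hlen : B.length = d := by simpa using congrArg List.length hbasis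
  have hB (w) : w ∈ B ↔ w.IsRooted ∧ level w = 0 := by
    simp [B, mem_rootedWords]
  let basis (k : Fin d) : FreeMagma (Fin n) := B.get (k.cast hlen.symm)
  have hcoord (k : Fin d) : coord (basis k) = (16 ^ d - 1) / 15 * 2 + 16 ^ (k : ℕ) := by
    have h := congrArg (fun l : List ℕ => l[(k : ℕ)]?) hbasis
    simpa [hlen, basis] using h
  refine finrank_raltMultilinSpace
    (fun w i => ((coord w / 16 ^ (i : ℕ) % 16 : ℕ) : ℚ) - 2) level basis (fun k => ⟨?_, ?_⟩)
    (fun w p q r hw h => ?_) fun w hw => ?_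
  · exact ((hB _).1 (B.get_mem _)).1
  · funext i
    rw [hcoord, hunit k k.2 i i.2]
    by_cases h : i = k
    · subst h
      norm_num
    · simp [h, Fin.val_inj]
  · obtain ⟨hp, hq, hr⟩ := hw.of_mem_rewrites h
    rw [← mem_rootedWords] at hw hp hq hr
    funext i
    have key := congrArg (fun m : ℕ => ((m / 16 ^ (i : ℕ) % 16 : ℕ) : ℚ)) ((hword w hw).2.1 _ h)
    simp only [add_div_pow_mod_sixteen (hsmall _ hw) (hsmall _ hr) i.2,
      add_div_pow_mod_sixteen (hsmall _ hp) (hsmall _ hq) i.2, Nat.cast_add] at key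
    simp only [Pi.add_apply]
    linarith
  · refine (hword w (mem_rootedWords.2 hw)).2.2.imp_left fun h => ?_
    obtain ⟨k, rfl⟩ := List.get_of_mem ((hB w).2 ⟨hw, h⟩)
    exact ⟨k.cast hlen, rfl⟩

end Packed

/-! ### The tables in arities four and five -/

/-- The number of bracketings of a word of length at most five. -/
def bracketingCount (k : ℕ) : ℕ := [0, 1, 1, 2, 5, 14].getD k 0

/-- The position of the bracketing of a word of length at most five in the enumeration given by
`FreeMagma.bracketings`. -/
def FreeMagma.bracketingIndex {α : Type*} : FreeMagma α → ℕ
  | .of _ => 0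
  | .mul a b =>
    let i := a.letters.length
    let j := b.letters.length
    ((List.range i).map fun k => bracketingCount k * bracketingCount (i + j - k)).sum +
      a.bracketingIndex * bracketingCount j + b.bracketingIndex

/-- The entry of a word in a table. The rows are indexed by the sequence of letters, read as a
decimal number, and the columns by the bracketing. -/
def tableEntry {n : ℕ} (T : List (ℕ × List (List ℕ))) (w : FreeMagma (Fin n)) : List ℕ :=
  ((T.lookup (w.letters.foldl (fun m a => 10 * m + a.val) 0)).getD []).getD w.bracketingIndex []

/-- The first number in a table entry. -/
def tableLevel {n : ℕ} (T : List (ℕ × List (List ℕ))) (w : FreeMagma (Fin n)) : ℕ :=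
  (tableEntry T w).headD 0

/-- The packed coordinate vector of length `d` encoded by a table entry, in which the number
`5 * i + c + 2` stands for the coordinate `c` at position `i`. -/
def tableCoord {n : ℕ} (T : List (ℕ × List (List ℕ))) (d : ℕ) (w : FreeMagma (Fin n)) : ℕ :=
  (tableEntry T w).tail.foldl (fun m c => m + c % 5 * 16 ^ (c / 5) - 2 * 16 ^ (c / 5))
    ((16 ^ d - 1) / 15 * 2)

/-- The table of rooted words in arity four. -/
def tableFour : List (ℕ × List (List ℕ)) :=
  [(123, [[1, 3, 26, 38], [1, 8, 61, 73], [0, 3], [2, 8, 16, 23, 56, 68], [0, 8]]),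
   (213, [[0, 13], [0, 18], [1, 23, 31, 43], [1, 18, 58, 66], [0, 23]]),
   (231, [[1, 11, 18, 28], [0, 28], [0, 33], [0, 38], [0, 43]]),
   (132, [[2, 1, 8, 36, 43, 48, 61, 73], [1, 26, 43, 48], [1, 1, 8, 48], [2, 13, 21, 26, 33, 48],
     [0, 48]]),
   (312, [[2, 16, 23, 53, 56, 63], [1, 16, 23, 53], [1, 53, 66, 73], [2, 11, 23, 28, 31, 53], [0,
     53]]),
   (321, [[0, 58], [0, 63], [0, 68], [1, 36, 43, 73], [0, 73]])]

/-- The table of rooted words in arity five. -/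
def tableFive : List (ℕ × List (List ℕ)) :=
  [(1234, [[4, 13, 33, 36, 93, 96, 201, 213, 253, 256, 268, 281], [0, 3], [1, 13, 241, 253], [3, 3,
     103, 116, 188, 191, 398, 406], [0, 8], [3, 18, 93, 111, 201, 213, 248, 256], [2, 23, 401, 408,
     463, 466], [0, 13], [0, 18], [1, 23, 76, 83], [2, 23, 83, 86, 128, 131], [0, 23], [0, 28], [3,
     23, 401, 408, 463, 471]]),
   (2134, [[2, 38, 91, 98, 246, 258], [4, 38, 121, 133, 206, 218, 246, 263, 326, 333, 373, 376],
     [1, 38, 246, 258], [6, 38, 53, 86, 246, 263, 318, 326, 353, 356, 376, 393, 493, 496, 508,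
     511], [2, 38, 246, 258, 318, 326], [0, 33], [2, 38, 333, 341, 376, 393], [1, 11, 18, 38], [0,
     38], [1, 43, 71, 78], [0, 43], [3, 38, 333, 341, 353, 356, 376, 393], [4, 23, 26, 38, 333,
     341, 401, 408, 463, 471], [1, 38, 333, 341]]),
   (2314, [[2, 48, 93, 101, 323, 326], [8, 58, 136, 148, 248, 261, 328, 341, 348, 356, 371, 393,
     441, 448, 486, 498], [0, 48], [5, 88, 258, 261, 351, 358, 378, 391, 491, 498, 506, 513], [0,
     53], [1, 58, 106, 113], [0, 58], [0, 63], [0, 68], [0, 73], [0, 78], [4, 88, 351, 358, 378,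
     391], [0, 83], [0, 88]]),
   (2341, [[8, 46, 58, 103, 136, 148, 248, 261, 321, 329, 341, 348, 356, 371, 393, 441, 448, 486,
     498], [0, 93], [1, 46, 53, 103], [0, 98], [0, 103], [0, 108], [0, 113], [2, 61, 83, 118, 186,
     193], [1, 66, 88, 118], [3, 13, 16, 33, 36, 113, 246, 253, 268, 281], [3, 3, 21, 103, 403,
     406, 461, 468], [1, 33, 36, 113], [1, 118, 186, 193], [0, 118]]),
   (1324, [[6, 133, 203, 206, 241, 263, 266, 283, 288, 291, 326, 343, 388, 391], [7, 1, 8, 101,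
     118, 133, 176, 193, 198, 206, 246, 263, 326, 343, 388, 391, 396, 418, 456, 473], [1, 123, 371,
     388], [7, 1, 8, 101, 118, 133, 186, 193, 198, 206, 246, 263, 326, 343, 388, 391, 396, 408],
     [6, 133, 198, 206, 246, 263, 326, 343, 388, 391], [3, 133, 203, 206, 303, 311], [1, 133, 401,
     418], [3, 123, 348, 366, 371, 383, 441, 448], [0, 123], [0, 128], [1, 76, 88, 133], [2, 133,
     401, 408, 463, 471], [4, 36, 43, 71, 88, 133, 331, 343, 351, 358, 378, 391], [0, 133]]),
   (3124, [[8, 36, 43, 153, 183, 191, 223, 226, 243, 261, 268, 281, 286, 293, 303, 311, 328, 331,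
     356, 368, 381, 386, 394, 413, 416], [5, 36, 43, 153, 243, 261, 268, 276, 298, 311, 328, 331],
     [0, 138], [6, 143, 156, 163, 238, 246, 326, 338, 356, 363, 381, 393, 413, 416], [0, 143], [7,
     36, 43, 153, 183, 191, 223, 226, 243, 261, 268, 281, 293, 311, 328, 331, 386, 393], [4, 36,
     43, 153, 243, 261, 268, 276, 293, 311, 328, 331], [0, 148], [4, 148, 348, 366, 371, 383, 441,
     448], [6, 21, 28, 36, 43, 153, 161, 168, 268, 271, 308, 311, 328, 331, 403, 406, 461, 473],
     [0, 153], [5, 36, 43, 83, 86, 128, 131, 153, 161, 168, 268, 271, 308, 311, 328, 331, 403, 406,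
     461, 473], [5, 73, 86, 153, 353, 356, 376, 393], [2, 36, 43, 153, 331, 343]]),
   (3214, [[7, 58, 66, 106, 118, 163, 171, 193, 221, 233, 238, 261, 321, 338, 356, 363, 381, 393],
     [4, 163, 326, 338, 356, 363, 381, 393, 413, 416], [6, 163, 171, 178, 238, 246, 326, 338, 356,
     363, 381, 393, 413, 416], [0, 158], [5, 163, 238, 246, 326, 338, 356, 363, 381, 393, 413,
     416], [8, 58, 66, 106, 118, 163, 171, 193, 221, 233, 238, 261, 356, 363, 381, 393], [0, 163],
     [7, 58, 61, 106, 118, 163, 171, 193, 238, 261, 356, 363, 381, 393], [7, 58, 66, 106, 118, 163,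
     171, 193, 238, 261, 356, 363, 381, 393], [5, 23, 26, 38, 41, 163, 266, 273, 306, 313, 326,
     333, 401, 408, 463, 471], [0, 168], [3, 163, 266, 273, 306, 313, 326, 343], [3, 128, 131, 168,
     403, 406, 461, 473], [4, 83, 86, 128, 131, 168, 403, 406, 461, 473]]),
   (3241, [[8, 38, 41, 56, 68, 108, 116, 138, 151, 173, 228, 231, 236, 263, 323, 326, 333, 341,
     358, 366, 383, 391], [7, 38, 41, 138, 151, 193, 221, 228, 333, 341, 358, 366, 383, 391, 411,
     418], [0, 173], [6, 183, 243, 261, 268, 281, 286, 293, 303, 311, 328, 341, 386, 393], [0,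
     178], [8, 38, 41, 56, 68, 108, 116, 148, 151, 173, 228, 231, 236, 263, 333, 341, 348, 358,
     361, 366, 371, 384, 391, 441, 448], [6, 38, 41, 148, 151, 193, 221, 228, 333, 341, 348, 366,
     371, 383, 441, 448], [8, 56, 63, 108, 116, 128, 131, 161, 168, 173, 188, 191, 236, 263, 358,
     361, 383, 391, 403, 406, 461, 473], [7, 56, 68, 83, 86, 108, 116, 128, 131, 161, 168, 173,
     236, 263, 358, 361, 383, 391, 403, 406, 461, 473], [0, 183], [7, 1, 8, 101, 118, 193, 198,
     206, 246, 263, 326, 343, 388, 391, 396, 403, 456, 473], [5, 183, 243, 261, 268, 281, 293, 311,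
     328, 341, 386, 393], [0, 188], [0, 193]]),
   (1342, [[6, 1, 8, 101, 118, 176, 193, 198, 286, 293, 396, 418, 456, 473], [2, 203, 241, 248,
     266, 283], [0, 198], [3, 33, 36, 93, 96, 213, 248, 256], [5, 123, 131, 208, 248, 261, 328,
     341, 371, 393], [2, 208, 301, 313, 401, 418], [0, 203], [7, 36, 43, 71, 88, 208, 248, 261,
     328, 331, 351, 368, 378, 381, 443, 446], [0, 208], [0, 213], [0, 218], [2, 93, 111, 213, 248,
     256], [6, 123, 131, 208, 248, 261, 328, 341, 348, 356, 371, 393], [1, 123, 131, 208]]),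
   (3142, [[8, 178, 181, 228, 246, 263, 276, 283, 288, 291, 298, 301, 326, 343, 358, 366, 383, 388,
     390], [5, 178, 191, 223, 246, 263, 326, 343, 413, 416], [8, 38, 41, 143, 151, 228, 246, 263,
     326, 333, 358, 366, 383, 391], [3, 58, 66, 106, 118, 233, 321, 343], [8, 38, 41, 138, 151,
     228, 246, 263, 326, 333, 358, 366, 383, 391], [7, 181, 193, 228, 276, 283, 388, 391], [0,
     223], [8, 38, 41, 73, 86, 228, 246, 263, 326, 333, 353, 366, 376, 383, 441, 448], [0, 228],
     [4, 48, 66, 93, 101, 111, 118, 233, 326, 343], [6, 38, 41, 148, 151, 228, 333, 341, 348, 366,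
     371, 383, 441, 448, 486, 498], [0, 233], [7, 38, 41, 148, 151, 228, 246, 263, 326, 333, 358,
     366, 383, 391, 441, 448], [5, 38, 41, 148, 151, 228, 333, 341, 348, 366, 371, 383, 441,
     448]]),
   (3412, [[7, 38, 41, 143, 151, 156, 163, 238, 246, 263, 266, 278, 296, 313, 325, 333, 338, 356,
     363, 381, 393, 413, 416], [0, 238], [0, 243], [7, 38, 41, 56, 68, 108, 116, 138, 151, 228,
     231, 263, 323, 326, 333, 341, 358, 366, 383, 391], [0, 248], [6, 83, 86, 128, 131, 161, 168,
     263, 271, 278, 403, 406, 461, 473], [5, 83, 86, 128, 131, 161, 168, 263, 403, 406, 461, 473],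
     [0, 253], [1, 243, 293, 306], [7, 38, 41, 46, 68, 103, 116, 148, 151, 228, 231, 248, 328, 333,
     340, 348, 366, 371, 383, 441, 448, 486, 498], [1, 93, 111, 248], [6, 38, 41, 148, 151, 228,
     231, 263, 333, 341, 348, 366, 371, 383, 441, 448], [0, 258], [0, 263]]),
   (3421, [[5, 158, 161, 268, 328, 336, 358, 361, 383, 391, 411, 418], [6, 38, 41, 143, 151, 246,
     263, 278, 296, 313, 326, 333], [0, 268], [7, 178, 181, 246, 263, 283, 288, 291, 301, 313, 326,
     343, 388, 391], [1, 243, 246, 268], [0, 273], [0, 278], [2, 13, 16, 246, 258, 268], [2, 268,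
     308, 311, 328, 341], [7, 1, 8, 101, 118, 181, 193, 198, 206, 246, 263, 283, 326, 343, 388,
     391, 396, 403, 456, 473], [0, 283], [6, 181, 193, 283, 388, 391], [2, 13, 16, 246, 253, 268],
     [3, 243, 261, 268, 293, 311, 328, 341]]),
   (1243, [[5, 3, 11, 31, 38, 91, 98, 123, 131, 208, 211, 243, 251, 258, 261, 293, 328, 341, 371,
     393], [5, 123, 131, 201, 208, 243, 261, 268, 281, 293, 328, 341, 371, 393], [2, 8, 11, 243,
     251, 293], [0, 288], [0, 293], [4, 16, 23, 91, 113, 123, 131, 208, 211, 246, 258, 313, 401,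
     408, 463, 466], [2, 123, 131, 201, 208, 313], [1, 11, 28, 308], [4, 16, 23, 313, 401, 408,
     463, 471], [3, 303, 356, 368, 381, 393, 413, 416], [0, 298], [0, 303], [0, 308], [0, 313]]),
   (2143, [[4, 96, 103, 121, 133, 206, 218, 256, 263, 333, 373, 376], [1, 91, 103, 328], [0, 318],
     [0, 323], [0, 328], [3, 31, 38, 111, 118, 333, 376, 393], [1, 111, 118, 343], [5, 13, 16, 23,
     26, 306, 313, 333, 401, 408, 463, 471], [0, 333], [0, 338], [3, 338, 356, 363, 381, 393, 413,
     416], [2, 58, 66, 106, 118, 343], [1, 306, 313, 343], [0, 343]]),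
   (2413, [[7, 53, 86, 123, 131, 208, 216, 318, 331, 348, 353, 356, 371, 393, 493, 496, 508, 511],
     [7, 53, 56, 246, 263, 326, 343, 358, 383, 391, 488, 496], [0, 348], [4, 136, 148, 321, 328,
     348, 371, 383, 441, 448], [3, 136, 148, 348, 371, 383, 441, 448], [0, 353], [2, 56, 88, 358,
     383, 391], [2, 368, 381, 388, 443, 446], [0, 358], [0, 363], [2, 358, 383, 391, 411, 418], [3,
     56, 68, 108, 116, 358, 383, 391], [0, 368], [1, 358, 383, 391]]),
   (2431, [[8, 56, 88, 246, 258, 326, 343, 346, 351, 359, 373, 378, 383, 390, 488, 491, 506, 513],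
     [3, 123, 131, 208, 216, 258, 261, 318, 331, 378], [2, 136, 148, 383, 441, 448], [1, 96, 103,
     373], [0, 373], [3, 56, 88, 351, 358, 378, 383, 391], [0, 378], [1, 383, 441, 448], [0, 383],
     [5, 3, 11, 18, 21, 31, 38, 103, 111, 243, 248, 251, 261, 293, 311, 328, 341, 393, 403, 406,
     461, 468], [4, 243, 261, 268, 281, 293, 311, 328, 341, 393], [2, 31, 38, 111, 118, 393], [0,
     388], [0, 393]]),
   (1423, [[0, 398], [5, 3, 6, 103, 116, 248, 261, 328, 341, 398, 458, 471], [2, 101, 118, 186,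
     193, 408], [5, 176, 193, 248, 261, 286, 293, 328, 341, 418], [4, 176, 193, 248, 261, 328, 341,
     418], [1, 403, 461, 468], [0, 403], [3, 48, 61, 101, 118, 186, 193, 408], [0, 408], [4, 298,
     301, 358, 366, 383, 391, 418], [0, 413], [1, 301, 313, 418], [3, 56, 68, 108, 116, 338, 341,
     413], [0, 418]]),
   (4123, [[8, 76, 83, 128, 131, 161, 168, 236, 248, 328, 336, 358, 361, 383, 386, 403, 406, 411,
     418, 428, 438, 451, 461, 473, 476, 483], [7, 83, 86, 128, 131, 161, 168, 236, 263, 318, 331,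
     336, 343, 358, 361, 383, 391, 403, 406, 411, 418, 428, 461, 473, 503, 511, 516, 523], [7, 51,
     83, 128, 131, 161, 168, 236, 248, 328, 336, 358, 361, 383, 391, 403, 406, 411, 418, 428, 461,
     473, 476, 498], [7, 36, 43, 83, 86, 128, 131, 141, 153, 158, 160, 168, 236, 248, 268, 271,
     298, 311, 329, 331, 336, 358, 361, 383, 391, 403, 406, 411, 418, 423, 461, 473], [6, 83, 86,
     128, 131, 161, 168, 236, 263, 336, 343, 358, 361, 383, 391, 403, 406, 411, 418, 428, 461,
     473], [8, 3, 21, 103, 116, 128, 131, 161, 168, 188, 191, 236, 248, 328, 336, 358, 361, 383,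
     386, 398, 403, 405, 411, 418, 428, 438, 451, 461, 473, 476, 483], [7, 8, 21, 161, 168, 236,
     263, 318, 331, 336, 343, 358, 361, 383, 391, 403, 406, 411, 418, 428, 461, 473, 503, 511, 516,
     523], [8, 46, 63, 103, 116, 128, 131, 161, 168, 188, 191, 236, 248, 328, 336, 358, 361, 383,
     391, 403, 406, 411, 418, 428, 461, 473, 476, 498], [7, 128, 131, 161, 168, 236, 248, 328, 336,
     358, 361, 383, 391, 403, 406, 411, 418, 428, 461, 473, 476, 498], [0, 423], [4, 336, 343, 358,
     361, 383, 391, 411, 418, 428], [1, 298, 306, 423], [4, 58, 66, 106, 118, 336, 343, 411, 418,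
     428], [0, 428]]),
   (4213, [[7, 36, 43, 51, 71, 78, 88, 248, 261, 316, 328, 351, 368, 378, 381, 388, 391, 433, 446,
     453, 481, 498, 506, 513], [7, 21, 28, 36, 43, 296, 308, 331, 343, 356, 368, 381, 393, 403,
     406, 421, 428, 433, 461, 473, 523, 526], [7, 36, 43, 71, 88, 196, 208, 248, 261, 328, 331,
     351, 368, 378, 381, 433, 446, 453], [4, 156, 163, 266, 273, 296, 313, 326, 343, 356, 368, 381,
     393, 421, 428, 433], [7, 36, 43, 141, 153, 248, 261, 328, 331, 356, 368, 381, 393, 433], [4,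
     356, 368, 381, 388, 433, 446, 453, 481, 493], [6, 21, 28, 246, 258, 296, 308, 318, 326, 331,
     343, 356, 368, 381, 393, 403, 406, 421, 428, 433, 461, 473, 523, 526], [1, 433, 441, 453], [3,
     356, 368, 381, 388, 433, 446, 453], [4, 296, 313, 336, 343, 361, 368, 411, 418, 421, 428,
     433], [3, 296, 313, 356, 368, 381, 393, 433], [3, 296, 308, 356, 368, 381, 393, 421, 428,
     433], [0, 433], [2, 356, 368, 381, 393, 433]]),
   (4231, [[8, 21, 28, 73, 86, 246, 263, 296, 308, 318, 326, 331, 343, 353, 356, 376, 393, 403,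
     406, 421, 428, 448, 461, 473, 508, 511, 523, 526], [3, 51, 78, 388, 391, 453, 481, 498], [6,
     73, 86, 141, 153, 353, 356, 376, 393, 448], [0, 438], [1, 196, 208, 453], [7, 21, 28, 246,
     258, 296, 308, 318, 326, 331, 343, 403, 406, 421, 428, 448, 461, 473, 491, 498, 523, 526], [2,
     388, 391, 453, 481, 498], [0, 443], [0, 448], [2, 398, 401, 438, 463, 466], [6, 3, 6, 103,
     116, 196, 208, 248, 261, 328, 341, 398, 401, 453, 458, 471], [4, 3, 21, 103, 116, 188, 191,
     398, 406, 438], [0, 453], [1, 388, 391, 453]]),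
   (1432, [[0, 458], [4, 1, 8, 101, 118, 246, 263, 326, 343, 473], [2, 176, 188, 406, 418, 473],
     [4, 31, 38, 91, 98, 101, 118, 123, 131, 208, 211, 246, 258, 371, 393, 473], [3, 101, 118, 246,
     263, 326, 343, 473], [0, 463], [0, 468], [5, 56, 63, 108, 116, 188, 191, 246, 263, 326, 338,
     406, 413, 473], [1, 406, 418, 473], [3, 91, 113, 211, 218, 246, 263, 473], [2, 91, 113, 246,
     263, 473], [3, 91, 113, 123, 131, 208, 211, 246, 258, 473], [4, 48, 66, 101, 118, 246, 263,
     326, 343, 473], [0, 473]]),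
   (4132, [[4, 196, 208, 318, 331, 436, 453, 478, 503, 511, 516, 523], [7, 76, 88, 196, 208, 248,
     261, 328, 341, 386, 393, 483], [0, 478], [7, 51, 88, 248, 261, 316, 328, 333, 341, 498, 506,
     513], [6, 51, 88, 248, 261, 328, 341, 498], [8, 1, 8, 101, 118, 126, 133, 186, 193, 246, 263,
     318, 326, 331, 343, 388, 391, 396, 408, 436, 453, 478, 503, 511, 516, 523], [0, 483], [7, 58,
     61, 106, 118, 126, 133, 163, 166, 186, 193, 238, 261, 356, 363, 381, 393, 401, 408, 463, 471,
     478], [6, 126, 133, 163, 166, 238, 246, 326, 338, 356, 363, 381, 393, 401, 408, 413, 416, 463,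
     471, 478], [7, 123, 131, 208, 216, 248, 261, 328, 341, 348, 356, 371, 393, 493], [0, 488], [0,
     493], [5, 46, 68, 103, 116, 248, 261, 328, 341, 498], [0, 498]]),
   (4312, [[8, 36, 43, 141, 153, 158, 161, 248, 261, 268, 271, 298, 311, 316, 329, 341, 423, 426,
     513, 518, 521], [8, 23, 26, 141, 153, 248, 261, 298, 306, 316, 328, 333, 341, 401, 408, 423,
     426, 463, 471, 513, 521, 528], [0, 503], [0, 508], [1, 316, 333, 513], [8, 23, 26, 163, 166,
     238, 261, 298, 306, 316, 333, 338, 341, 356, 363, 381, 393, 401, 408, 413, 416, 423, 426, 463,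
     471, 513, 518, 521], [7, 23, 26, 248, 261, 298, 306, 316, 328, 333, 341, 401, 408, 423, 426,
     463, 471, 513, 521, 528], [2, 8, 26, 243, 251, 293, 306, 503], [1, 8, 26, 503], [8, 246, 258,
     326, 343, 346, 358, 373, 391, 488, 491, 513], [2, 123, 131, 208, 216, 258, 261, 513], [2, 258,
     261, 491, 498, 513], [0, 513], [1, 258, 261, 513]]),
   (4321, [[6, 23, 26, 38, 41, 156, 163, 266, 273, 306, 313, 326, 333, 401, 408, 463, 471, 528],
     [0, 518], [0, 523], [3, 196, 208, 318, 331, 436, 453, 503, 511, 523], [2, 318, 331, 503, 511,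
     523], [0, 528], [6, 163, 166, 238, 246, 326, 338, 356, 363, 381, 393, 413, 416, 518], [6, 11,
     18, 21, 28, 308, 311, 318, 331, 403, 406, 461, 473, 523], [5, 21, 28, 246, 258, 318, 326, 331,
     343, 403, 406, 461, 473, 523], [4, 196, 208, 318, 331, 436, 453, 458, 461, 503, 511, 523], [5,
     1, 8, 101, 118, 246, 263, 318, 326, 331, 343, 466, 473, 503, 511, 523], [7, 1, 8, 101, 118,
     186, 193, 246, 263, 318, 326, 331, 343, 388, 391, 396, 403, 436, 453, 461, 473, 503, 511,
     523], [5, 8, 11, 18, 21, 243, 251, 293, 311, 318, 331, 403, 406, 461, 473, 503, 511, 523], [6,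
     8, 21, 246, 263, 318, 326, 331, 343, 403, 406, 461, 473, 503, 511, 523]])]

theorem finrank_raltMultilinSpace_four : Module.finrank ℚ (raltMultilinSpace 4) = 60 :=
  finrank_raltMultilinSpace_of_packed 15 (tableCoord tableFour 15) (tableLevel tableFour)
    (by decide +kernel) (by decide +kernel) (by decide +kernel) (by decide +kernel)

theorem finrank_raltMultilinSpace_five : Module.finrank ℚ (raltMultilinSpace 5) = 530 :=
  finrank_raltMultilinSpace_of_packed 106 (tableCoord tableFive 106) (tableLevel tableFive)
    (by decide +kernel) (by decide +kernel) (by decide +kernel) (by decide +kernel)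

/-- `dim RAlt(4) = 60` and `dim RAlt(5) = 530`. -/
theorem ralt_dimensions_four_five :
    Module.finrank ℚ (raltMultilinSpace 4) = 60 ∧
    Module.finrank ℚ (raltMultilinSpace 5) = 530 := by
  exact ⟨finrank_raltMultilinSpace_four, finrank_raltMultilinSpace_five⟩
end

section
/- Let M be an m × k matrix whose entries all lie in {−1, 0, 1}, let r be the rank of M over ℚ, and let p₁, …, pₙ be pairwise distinct primes such that (p₁⋯pₙ)² > rʳ. Then there exists an index i such that the rank of the reduction of M modulo pᵢ (over the field ℤ/pᵢℤ) equals r. Consequently, if moreover the reductions of M modulo every pᵢ all have one and the same rank ρ, then r = ρ. -/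
namespace Matrix

/-- A matrix over a field has `A.rank` many linearly independent rows. -/
theorem exists_linearIndependent_row_submatrix {K m n : Type*} [Field K] [Finite m] [Fintype n]
    (A : Matrix m n K) :
    ∃ f : Fin A.rank → m, LinearIndependent K (A.submatrix f id).row := by
  rw [rank_eq_finrank_span_row]
  obtain ⟨g, hg, -, hlin⟩ := Submodule.exists_fun_fin_finrank_span_eq K (Set.range A.row)
  choose f hf using hg
  exact ⟨f, by convert! hlin using 1; exact funext hf⟩

/-- A matrix over a field has a nonsingular square submatrix whose size is its rank. -/
theorem exists_det_submatrix_ne_zero {K m n : Type*} [Field K] [Fintype m] [Fintype n]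
    {A : Matrix m n K} {r : ℕ} (hA : A.rank = r) :
    ∃ (f : Fin r → m) (g : Fin r → n), (A.submatrix f g).det ≠ 0 := by
  subst hA
  obtain ⟨f, hf⟩ := A.exists_linearIndependent_row_submatrix
  have hrank : (A.submatrix f id)ᵀ.rank = A.rank := by
    rw [rank_transpose, hf.rank_matrix, Fintype.card_fin]
  have hcols := (A.submatrix f id)ᵀ.exists_linearIndependent_row_submatrix
  rw [hrank] at hcols
  obtain ⟨g, hg⟩ := hcols
  refine ⟨f, g, ?_⟩
  rw [← det_transpose, ← isUnit_iff_ne_zero, ← isUnit_iff_isUnit_det]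
  exact linearIndependent_rows_iff_isUnit.mp hg

/-- The rank of a matrix is at least the size of any nonsingular square submatrix. -/
theorem le_rank_of_det_submatrix_ne_zero {K m n : Type*} [Field K] [Fintype n]
    {A : Matrix m n K} {r : ℕ} (f : Fin r → m) (g : Fin r → n)
    (h : (A.submatrix f g).det ≠ 0) : r ≤ A.rank := by
  simpa [rank_of_det_ne_zero h] using A.rank_submatrix_le f g

/-- **Hadamard's inequality** for real matrices. -/
theorem abs_det_le_prod_norm_row {n : ℕ} (A : Matrix (Fin n) (Fin n) ℝ) :
    |A.det| ≤ ∏ i, ‖WithLp.toLp 2 (A i)‖ := by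
  let b := EuclideanSpace.basisFun (Fin n) ℝ
  have : Fact (Module.finrank ℝ (EuclideanSpace ℝ (Fin n)) = n) := ⟨by simp⟩
  have h := b.toBasis.orientation.abs_volumeForm_apply_le fun i => WithLp.toLp 2 (A i)
  rw [Orientation.volumeForm_robust' _ b, Module.Basis.det_apply] at h
  have hA : b.toBasis.toMatrix (fun i => WithLp.toLp 2 (A i)) = Aᵀ := by
    ext i j
    simp [b, Module.Basis.toMatrix_apply]
  rwa [hA, det_transpose] at h

/-- Hadamard's bound for the determinant of an integer matrix with entries in `{-1, 0, 1}`. -/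
theorem det_sq_le_pow_self {n : ℕ} (A : Matrix (Fin n) (Fin n) ℤ)
    (hA : ∀ i j, A i j = -1 ∨ A i j = 0 ∨ A i j = 1) : A.det ^ 2 ≤ (n : ℤ) ^ n := by
  have h := (A.map (Int.cast : ℤ → ℝ)).abs_det_le_prod_norm_row
  have hdet : (A.map (Int.cast : ℤ → ℝ)).det = A.det := (Int.cast_det A).symm
  have hrow (i : Fin n) : ‖WithLp.toLp 2 (A.map (Int.cast : ℤ → ℝ) i)‖ ^ 2 ≤ n := by
    rw [EuclideanSpace.norm_sq_eq]
    calc _ ≤ ∑ _j : Fin n, (1 : ℝ) := by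
          refine Finset.sum_le_sum fun j _ => ?_
          rcases hA i j with h | h | h <;> simp [h]
      _ = n := by simp
  have hsq : (A.det : ℝ) ^ 2 ≤ (n : ℝ) ^ n := by
    calc (A.det : ℝ) ^ 2 = |(A.det : ℝ)| ^ 2 := (sq_abs _).symm
      _ ≤ (∏ i, ‖WithLp.toLp 2 (A.map (Int.cast : ℤ → ℝ) i)‖) ^ 2 := by
          rw [← hdet]; gcongr
      _ = ∏ i, ‖WithLp.toLp 2 (A.map (Int.cast : ℤ → ℝ) i)‖ ^ 2 := (Finset.prod_pow ..).symm
      _ ≤ ∏ _i : Fin n, (n : ℝ) := Finset.prod_le_prod (fun _ _ => by positivity) fun i _ => hrow i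
      _ = (n : ℝ) ^ n := by simp
  exact_mod_cast hsq

/-- The determinant of a submatrix of the image of an integer matrix in a commutative ring. -/
theorem det_submatrix_map_intCast {R m n : Type*} [CommRing R] {r : ℕ} (M : Matrix m n ℤ)
    (f : Fin r → m) (g : Fin r → n) :
    ((M.map (fun a => (a : R))).submatrix f g).det = ((M.submatrix f g).det : R) :=
  (Int.cast_det (M.submatrix f g)).symm

/-- Mapping an integer matrix into any field does not increase its rank over `ℚ`. -/
theorem rank_map_intCast_le {K m n : Type*} [Field K] [Fintype m] [Fintype n]
    (M : Matrix m n ℤ) :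
    (M.map (fun a => (a : K))).rank ≤ (M.map (fun a => (a : ℚ))).rank := by
  obtain ⟨f, g, h⟩ := exists_det_submatrix_ne_zero (A := M.map (fun a => (a : K))) rfl
  refine le_rank_of_det_submatrix_ne_zero f g ?_
  rw [det_submatrix_map_intCast] at h ⊢
  exact Int.cast_ne_zero.mpr fun h0 => h (by rw [h0, Int.cast_zero])

end Matrix

/-- Modular rank computation certifies the rational rank: if `M` is an integer
matrix with entries in `{−1, 0, 1}` of rank `r` over `ℚ`, and `p₁, …, pₙ` are
pairwise distinct primes with `(p₁⋯pₙ)² > rʳ`, then the reduction of `M` modulo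
some `pᵢ` has rank `r`; consequently, if the reductions modulo all the `pᵢ`
have one and the same rank `ρ`, then `r = ρ`. -/
theorem rank_certified_by_modular_ranks
    (m k : ℕ) (M : Matrix (Fin m) (Fin k) ℤ)
    (hM : ∀ i j, M i j = -1 ∨ M i j = 0 ∨ M i j = 1)
    (r : ℕ) (hr : (M.map (fun a => (a : ℚ))).rank = r)
    (n : ℕ) (p : Fin n → ℕ) (hp : ∀ i, (p i).Prime)
    (hdist : Function.Injective p)
    (hbound : (∏ i, p i) ^ 2 > r ^ r) :
    (∃ i, (M.map (fun a => (a : ZMod (p i)))).rank = r) ∧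
      ∀ ρ : ℕ, (∀ i, (M.map (fun a => (a : ZMod (p i)))).rank = ρ) → r = ρ := by
  have hexists : ∃ i, (M.map (fun a => (a : ZMod (p i)))).rank = r := by
    obtain ⟨f, g, hdet⟩ := Matrix.exists_det_submatrix_ne_zero hr
    rw [Matrix.det_submatrix_map_intCast, Int.cast_ne_zero] at hdet
    set d := (M.submatrix f g).det
    have hle : d ^ 2 ≤ (r : ℤ) ^ r := Matrix.det_sq_le_pow_self _ fun i j => hM (f i) (g j)
    obtain ⟨i, hi⟩ : ∃ i, ¬ p i ∣ d.natAbs := by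
      by_contra! hall
      have hdvd : ∏ i, p i ∣ d.natAbs :=
        Fintype.prod_dvd_of_isRelPrime
          (fun i j hij => Nat.coprime_iff_isRelPrime.mp
            ((Nat.coprime_primes (hp i) (hp j)).mpr (hdist.ne hij))) hall
      have hprod := Nat.le_of_dvd (Int.natAbs_pos.mpr hdet) hdvd
      have hnat : d.natAbs ^ 2 ≤ r ^ r := by
        zify
        simpa using hle
      exact absurd (hbound.trans_le (Nat.pow_le_pow_left hprod 2)) hnat.not_gt
    have : Fact (p i).Prime := ⟨hp i⟩
    refine ⟨i, le_antisymm (hr ▸ M.rank_map_intCast_le) ?_⟩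
    refine Matrix.le_rank_of_det_submatrix_ne_zero f g ?_
    rwa [Matrix.det_submatrix_map_intCast, Ne, ZMod.intCast_zmod_eq_zero_iff_dvd,
      Int.natCast_dvd]
  obtain ⟨i, hi⟩ := hexists
  exact ⟨⟨i, hi⟩, fun ρ hρ => hi.symm.trans (hρ i)⟩
end

section
/- Let A be a non-unital associative ring in which 3x = 0 for every x ∈ A. Then A satisfies the symmetric-sum identity xyz + yxz + zxy + xzy + yzx + zyx = 0 for all x, y, z ∈ A if and only if A satisfies the 2-Engel identity [[x,y],y] = 0 for all x, y ∈ A, where [a,b] = ab − ba is the ring commutator. -/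
/-- In a non-unital associative ring of characteristic 3, the symmetric-sum
identity `xyz + yxz + zxy + xzy + yzx + zyx = 0` holds if and only if the
2-Engel identity `[[x,y],y] = 0` holds, where `[a,b] = ab − ba`. -/
theorem dualAlternative_iff_twoEngel_char_three
    (A : Type*) [NonUnitalRing A] (hchar : ∀ x : A, 3 • x = 0) :
    (∀ x y z : A, x * y * z + y * x * z + z * x * y
        + x * z * y + y * z * x + z * y * x = 0) ↔
      (∀ x y : A, (x * y - y * x) * y - y * (x * y - y * x) = 0) := by
  constructor
  · intro h x y
    have hE := hchar ((x * y - y * x) * y - y * (x * y - y * x))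
    have hyxy := hchar (y * x * y)
    calc (x * y - y * x) * y - y * (x * y - y * x)
        = 3 • ((x * y - y * x) * y - y * (x * y - y * x)) + 2 • (3 • (y * x * y))
          - (x * y * y + y * x * y + y * x * y + x * y * y + y * y * x + y * y * x) := by
          simp only [mul_sub, sub_mul, mul_assoc]
          abel
      _ = 0 := by rw [hE, hyxy, h x y y]; simp
  · intro h x y z
    calc x * y * z + y * x * z + z * x * y + x * z * y + y * z * x + z * y * x
        = ((x * (y + z) - (y + z) * x) * (y + z) - (y + z) * (x * (y + z) - (y + z) * x))
          - ((x * y - y * x) * y - y * (x * y - y * x))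
          - ((x * z - z * x) * z - z * (x * z - z * x))
          + 3 • (y * x * z + z * x * y) := by
          simp only [mul_sub, sub_mul, mul_add, add_mul, mul_assoc]
          abel
      _ = 0 := by rw [h, h, h, hchar]; simp
end
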